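/- arXiv:1809.01469 — 4 statements merged into one kernel-verified Lean document; each statement's English description precedes it below -/
import Mathlib

section
/- Fix integers d ≥ 1 and k ≥ 1. There exists a full-rank lattice Γ⋆ ⊂ ℝ^d with covolume |Γ⋆| = 1 such that Λ̃_k(Γ⋆) ≥ Λ̃_k(Γ) for every full-rank lattice Γ ⊂ ℝ^d; that is, the supremum of Λ̃_k over all full-rank lattices in ℝ^d is attained. -/
open scoped RealInnerProductSpace
open MeasureTheory

noncomputable section

/-- The full-rank lattice `A ℤ^d ⊂ ℝ^d` (Euclidean space), for `A ∈ GL_d(ℝ)`. -/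
def lat (d : ℕ) (A : Matrix (Fin d) (Fin d) ℝ) : Set (EuclideanSpace ℝ (Fin d)) :=
  {x | ∃ n : Fin d → ℤ, ∀ i, x i = ∑ j, A i j * (n j : ℝ)}

/-- `|γ_k(Γ)|`, the norm of the `k`-th lattice point when points are ordered by
non-decreasing norm (with `γ_0 = 0`):
`min {r ≥ 0 : #{γ ∈ Γ : ‖γ‖ ≤ r} ≥ k + 1}`. -/
def gammaNorm (d : ℕ) (A : Matrix (Fin d) (Fin d) ℝ) (k : ℕ) : ℝ :=
  sInf {r : ℝ | 0 ≤ r ∧ k + 1 ≤ ({γ ∈ lat d A | ‖γ‖ ≤ r}).ncard}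

/-- The scale-invariant functional `Λ̃_k(Γ) = |Γ|^{-1/d} |γ_k(Γ)|`, where the covolume
of the lattice `A ℤ^d` is `|det A|`. -/
def Lam (d : ℕ) (A : Matrix (Fin d) (Fin d) ℝ) (k : ℕ) : ℝ :=
  |A.det| ^ (-(1 : ℝ) / d) * gammaNorm d A k

/-- integer vector as a real vector -/
def ivec {d : ℕ} (n : Fin d → ℤ) : Fin d → ℝ := fun j => (n j : ℝ)

/-- lattice point as an element of Euclidean space -/
def pt {d : ℕ} (A : Matrix (Fin d) (Fin d) ℝ) (n : Fin d → ℤ) : EuclideanSpace ℝ (Fin d) :=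
  WithLp.toLp 2 (A.mulVec (ivec n))

lemma ivec_inj {d : ℕ} : Function.Injective (ivec (d := d)) := by
  intro a b h
  ext j
  have := congrFun h j
  simpa [ivec] using this

lemma lat_eq {d : ℕ} (A : Matrix (Fin d) (Fin d) ℝ) : lat d A = Set.range (pt A) := by
  ext x
  constructor
  · rintro ⟨n, hn⟩
    refine ⟨n, ?_⟩
    ext i
    rw [hn i]
    rfl
  · rintro ⟨n, rfl⟩
    exact ⟨n, fun i => rfl⟩

lemma pt_inj {d : ℕ} {A : Matrix (Fin d) (Fin d) ℝ} (hA : A.det ≠ 0) :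
    Function.Injective (pt A) := by
  intro a b h
  apply ivec_inj
  have h1 : A.mulVec (ivec a) = A.mulVec (ivec b) := (WithLp.toLp_injective 2) h
  exact Matrix.mulVec_injective_of_isUnit ((Matrix.isUnit_iff_isUnit_det A).2 hA.isUnit) h1

lemma abs_coord_le {d : ℕ} (x : EuclideanSpace ℝ (Fin d)) (i : Fin d) : |x i| ≤ ‖x‖ := by
  simpa using PiLp.norm_apply_le x i

lemma norm_le_of_coord {d : ℕ} (x : EuclideanSpace ℝ (Fin d)) {c : ℝ} (hc : 0 ≤ c)
    (h : ∀ i, |x i| ≤ c) : ‖x‖ ≤ d * c := by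
  rw [EuclideanSpace.norm_eq]
  apply Real.sqrt_le_iff.2
  refine ⟨by positivity, ?_⟩
  calc ∑ i, ‖x i‖ ^ 2 ≤ ∑ i : Fin d, c ^ 2 := by
        apply Finset.sum_le_sum
        intro i _
        have := h i
        rw [← Real.norm_eq_abs] at this
        gcongr
    _ = d * c ^ 2 := by simp
    _ ≤ (d * c) ^ 2 := by
        rw [mul_pow]
        gcongr
        rcases Nat.eq_zero_or_pos d with h0 | h0
        · simp [h0]
        · have : (1:ℝ) ≤ d := by exact_mod_cast h0
          nlinarith

lemma finite_pts {d : ℕ} {A : Matrix (Fin d) (Fin d) ℝ} (hA : A.det ≠ 0) (r : ℝ) :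
    {n : Fin d → ℤ | ‖pt A n‖ ≤ r}.Finite := by
  set M : ℝ := ∑ i, ∑ j, |A⁻¹ i j| with hM
  have hM0 : 0 ≤ M := by positivity
  apply Set.Finite.subset (Set.finite_Icc (fun _ : Fin d => -⌈M * r⌉) (fun _ => ⌈M * r⌉))
  intro n hn
  have key : ∀ i, |(n i : ℝ)| ≤ M * r := by
    intro i
    have h1 : ivec n = A⁻¹.mulVec (A.mulVec (ivec n)) := by
      rw [Matrix.mulVec_mulVec, Matrix.nonsing_inv_mul _ hA.isUnit, Matrix.one_mulVec]
    have h2 : (n i : ℝ) = ∑ j, A⁻¹ i j * (pt A n) j := congrFun h1 i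
    have hr : 0 ≤ r := (norm_nonneg _).trans hn
    rw [h2]
    calc |∑ j, A⁻¹ i j * (pt A n) j| ≤ ∑ j, |A⁻¹ i j * (pt A n) j| :=
          Finset.abs_sum_le_sum_abs _ _
      _ ≤ ∑ j, |A⁻¹ i j| * r := by
          apply Finset.sum_le_sum
          intro j _
          rw [abs_mul]
          have := (abs_coord_le (pt A n) j).trans hn
          gcongr
      _ = (∑ j, |A⁻¹ i j|) * r := by rw [Finset.sum_mul]
      _ ≤ M * r := by
          gcongr
          exact Finset.single_le_sum (f := fun i => ∑ j, |A⁻¹ i j|)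
            (fun i _ => by positivity) (Finset.mem_univ i)
  constructor
  · intro i
    have h1 := (abs_le.1 (key i)).1
    have h2 := Int.le_ceil (M * r)
    have : (-⌈M * r⌉ : ℝ) ≤ n i := by linarith
    exact_mod_cast this
  · intro i
    have h1 := (abs_le.1 (key i)).2
    have h2 := Int.le_ceil (M * r)
    have : (n i : ℝ) ≤ ⌈M * r⌉ := by linarith
    exact_mod_cast this

lemma latball_eq {d : ℕ} (A : Matrix (Fin d) (Fin d) ℝ) (r : ℝ) :
    {γ ∈ lat d A | ‖γ‖ ≤ r} = pt A '' {n | ‖pt A n‖ ≤ r} := by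
  rw [lat_eq]
  ext x
  constructor
  · rintro ⟨⟨n, rfl⟩, h⟩
    exact ⟨n, h, rfl⟩
  · rintro ⟨n, h, rfl⟩
    exact ⟨⟨n, rfl⟩, h⟩

lemma mem_gset {d k : ℕ} {A : Matrix (Fin d) (Fin d) ℝ} (hA : A.det ≠ 0) {r : ℝ} (hr : 0 ≤ r)
    (s : Finset (Fin d → ℤ)) (hs : s.card = k + 1) (h : ∀ n ∈ s, ‖pt A n‖ ≤ r) :
    r ∈ {r : ℝ | 0 ≤ r ∧ k + 1 ≤ ({γ ∈ lat d A | ‖γ‖ ≤ r}).ncard} := by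
  refine ⟨hr, ?_⟩
  rw [latball_eq, Set.ncard_image_of_injective _ (pt_inj hA), ← hs, ← Set.ncard_coe_finset]
  exact Set.ncard_le_ncard (fun n hn => h n hn) (finite_pts hA r)

lemma gammaNorm_le {d k : ℕ} {A : Matrix (Fin d) (Fin d) ℝ} (hA : A.det ≠ 0) {r : ℝ} (hr : 0 ≤ r)
    (s : Finset (Fin d → ℤ)) (hs : s.card = k + 1) (h : ∀ n ∈ s, ‖pt A n‖ ≤ r) :
    gammaNorm d A k ≤ r :=
  csInf_le ⟨0, fun _ h => h.1⟩ (mem_gset hA hr s hs h)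

lemma gammaNorm_lt_iff {d k : ℕ} (hd : 1 ≤ d) {A : Matrix (Fin d) (Fin d) ℝ} (hA : A.det ≠ 0)
    (y : ℝ) : gammaNorm d A k < y ↔
      ∃ s : Finset (Fin d → ℤ), s.card = k + 1 ∧ ∀ n ∈ s, ‖pt A n‖ < y := by
  constructor
  · intro h
    have hne : {r : ℝ | 0 ≤ r ∧ k + 1 ≤ ({γ ∈ lat d A | ‖γ‖ ≤ r}).ncard}.Nonempty := by
      have : Nonempty (Fin d) := ⟨⟨0, hd⟩⟩
      have : Infinite (Fin d → ℤ) := inferInstance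
      obtain ⟨s, hs⟩ := Infinite.exists_subset_card_eq (Fin d → ℤ) (k + 1)
      exact ⟨∑ n ∈ s, ‖pt A n‖, mem_gset hA (by positivity) s hs fun n hn =>
        Finset.single_le_sum (f := fun n => ‖pt A n‖) (fun i _ => norm_nonneg _) hn⟩
    obtain ⟨r, ⟨hr0, hr⟩, hry⟩ := exists_lt_of_csInf_lt hne h
    rw [latball_eq, Set.ncard_image_of_injective _ (pt_inj hA),
      Set.ncard_eq_toFinset_card _ (finite_pts hA r)] at hr
    obtain ⟨s, hs, hc⟩ := Finset.exists_subset_card_eq hr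
    refine ⟨s, hc, fun n hn => ?_⟩
    have := hs hn
    simp at this
    exact this.trans_lt hry
  · rintro ⟨s, hs, h⟩
    have hne : s.Nonempty := by
      rw [← Finset.card_pos]; omega
    obtain ⟨m, hm, hmax⟩ := Finset.exists_max_image s (fun n => ‖pt A n‖) hne
    exact (gammaNorm_le hA (norm_nonneg (pt A m)) s hs hmax).trans_lt (h m hm)

lemma pt_smul_right {d : ℕ} (A : Matrix (Fin d) (Fin d) ℝ) (c : ℤ) (n : Fin d → ℤ) :
    pt A (c • n) = (c : ℝ) • pt A n := by
  have : ivec (c • n) = (c : ℝ) • ivec n := by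
    ext j; simp [ivec]
  rw [pt, this, Matrix.mulVec_smul]; rfl

lemma pt_smul_left {d : ℕ} (A : Matrix (Fin d) (Fin d) ℝ) (c : ℝ) (n : Fin d → ℤ) :
    pt (c • A) n = c • pt A n := by
  simp [pt, Matrix.smul_mulVec]

lemma gammaNorm_le_mul {d k : ℕ} {A : Matrix (Fin d) (Fin d) ℝ} (hA : A.det ≠ 0)
    {n : Fin d → ℤ} (hn : n ≠ 0) : gammaNorm d A k ≤ k * ‖pt A n‖ := by
  have hinj : Function.Injective (fun c : ℕ => (c : ℤ) • n) := by
    intro a b h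
    have := smul_left_injective ℤ hn h
    exact_mod_cast this
  refine gammaNorm_le hA (by positivity) ((Finset.range (k + 1)).image (fun c : ℕ => (c : ℤ) • n))
    (by rw [Finset.card_image_of_injective _ hinj, Finset.card_range]) ?_
  intro m hm
  obtain ⟨c, hc, rfl⟩ := Finset.mem_image.1 hm
  have hc' : (c : ℝ) ≤ k := by
    have := Finset.mem_range.1 hc
    exact_mod_cast Nat.lt_succ_iff.1 this
  simp only [pt_smul_right, norm_smul]
  simp
  gcongr

lemma gammaNorm_smul {d k : ℕ} (hd : 1 ≤ d) {A : Matrix (Fin d) (Fin d) ℝ} (hA : A.det ≠ 0)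
    {c : ℝ} (hc : 0 < c) : c * gammaNorm d A k ≤ gammaNorm d (c • A) k := by
  have hA' : (c • A).det ≠ 0 := by
    rw [Matrix.det_smul]; positivity
  apply le_of_forall_gt
  intro y hy
  obtain ⟨s, hs, h⟩ := (gammaNorm_lt_iff hd hA' y).1 hy
  have : gammaNorm d A k < y / c := by
    refine (gammaNorm_lt_iff hd hA _).2 ⟨s, hs, fun n hn => ?_⟩
    have := h n hn
    rw [pt_smul_left, norm_smul, Real.norm_of_nonneg hc.le] at this
    rw [lt_div_iff₀ hc]; linarith
  rw [lt_div_iff₀ hc] at this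
  linarith

lemma one_le_gammaNorm_one {d k : ℕ} (hd : 1 ≤ d) (hk : 1 ≤ k) : 1 ≤ gammaNorm d 1 k := by
  by_contra! hlt
  obtain ⟨s, hs, h⟩ := (gammaNorm_lt_iff hd (by simp) _).1 hlt
  have : s ⊆ {0} := by
    intro n hn
    rw [Finset.mem_singleton]
    ext j
    have h1 := (abs_coord_le (pt 1 n) j).trans_lt (h n hn)
    simp only [pt, Matrix.one_mulVec, ivec] at h1
    have h2 : |n j| < 1 := by exact_mod_cast h1
    simpa using Int.abs_lt_one_iff.1 h2
  have := Finset.card_le_card this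
  simp at this
  omega

lemma usc {d k : ℕ} (hd : 1 ≤ d) (S : Set (Matrix (Fin d) (Fin d) ℝ))
    (hS : ∀ A ∈ S, A.det ≠ 0) : UpperSemicontinuousOn (fun A => gammaNorm d A k) S := by
  intro A hA y hy
  obtain ⟨s, hs, h⟩ := (gammaNorm_lt_iff hd (hS A hA) y).1 hy
  have hev : ∀ᶠ A' in nhds A, ∀ n ∈ s, ‖pt A' n‖ < y := by
    rw [Filter.eventually_all_finset]
    intro n hn
    have hcont : Continuous (fun A' : Matrix (Fin d) (Fin d) ℝ => ‖pt A' n‖) := by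
      unfold pt
      fun_prop
    exact hcont.continuousAt.eventually_lt continuousAt_const (h n hn)
  filter_upwards [hev.filter_mono nhdsWithin_le_nhds, self_mem_nhdsWithin] with A' h1 h2
  exact (gammaNorm_lt_iff hd (hS A' h2) y).2 ⟨s, hs, h1⟩

lemma mink {d : ℕ} {E : Matrix (Fin d) (Fin d) ℝ} (hE : E.det ≠ 0) (hE1 : |E.det| < 1) :
    ∃ n : Fin d → ℤ, n ≠ 0 ∧ ∀ i, |E.mulVec (ivec n) i| < 1 := by
  classical
  set s : Set (Fin d → ℝ) := (Matrix.toLin' E) ⁻¹' Metric.ball 0 1 with hs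
  have hdet : LinearMap.det (Matrix.toLin' E) ≠ 0 := by simpa using hE
  have hvol : volume s = ENNReal.ofReal |E.det|⁻¹ * ENNReal.ofReal (2 ^ d) := by
    rw [hs, Measure.addHaar_preimage_linearMap volume hdet, Real.volume_pi_ball _ one_pos]
    simp [abs_inv]
  have hfund : volume (ZSpan.fundamentalDomain (Pi.basisFun ℝ (Fin d))) = 1 := by
    rw [ZSpan.fundamentalDomain_pi_basisFun]
    simp [volume_pi, Measure.pi_pi]
  have hlt : volume (ZSpan.fundamentalDomain (Pi.basisFun ℝ (Fin d))) *
      2 ^ Module.finrank ℝ (Fin d → ℝ) < volume s := by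
    rw [hfund, hvol, one_mul, Module.finrank_fin_fun, ENNReal.ofReal_pow (by norm_num),
      ENNReal.ofReal_ofNat]
    have h1 : (1 : ENNReal) < ENNReal.ofReal |E.det|⁻¹ := by
      rw [← ENNReal.ofReal_one, ENNReal.ofReal_lt_ofReal_iff (by positivity)]
      exact (one_lt_inv₀ (by positivity)).2 hE1
    calc (2 : ENNReal) ^ d = 1 * 2 ^ d := (one_mul _).symm
      _ < _ := ENNReal.mul_lt_mul_left (by positivity) (by finiteness) h1
  have hconv : Convex ℝ s := (convex_ball _ _).linear_preimage _
  have hsymm : ∀ x ∈ s, -x ∈ s := by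
    intro x hx
    simpa [hs, Matrix.mulVec_neg] using hx
  have : Countable (Submodule.span ℤ (Set.range (Pi.basisFun ℝ (Fin d)))).toAddSubgroup :=
    inferInstanceAs (Countable (Submodule.span ℤ (Set.range (Pi.basisFun ℝ (Fin d)))))
  obtain ⟨x, hx0, hxs⟩ := exists_ne_zero_mem_lattice_of_measure_mul_two_pow_lt_measure
    (ZSpan.isAddFundamentalDomain' (Pi.basisFun ℝ (Fin d)) volume) hsymm hconv hlt
  have hx2 := ((Pi.basisFun ℝ (Fin d)).mem_span_iff_repr_mem ℤ (x : Fin d → ℝ)).1 x.2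
  choose n hn using hx2
  have hxn : (x : Fin d → ℝ) = ivec n := by
    ext i
    have := hn i
    simp at this
    exact this.symm
  refine ⟨n, ?_, ?_⟩
  · rintro rfl
    apply hx0
    apply Subtype.ext
    rw [hxn]
    ext i
    simp [ivec]
  · intro i
    rw [hxn] at hxs
    have h1 : ‖E.mulVec (ivec n)‖ < 1 := by simpa [hs] using hxs
    exact (norm_le_pi_norm (E.mulVec (ivec n)) i).trans_lt h1

lemma fin_rep (d q : ℕ) (hq : 0 < q) : ∃ R : ℝ, 0 ≤ R ∧ ∀ M N : Matrix (Fin d) (Fin d) ℤ,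
    M * N = (q : ℤ) • (1 : Matrix (Fin d) (Fin d) ℤ) →
    ∃ M' : Matrix (Fin d) (Fin d) ℤ, (∀ i j, |(M' i j : ℝ)| ≤ R) ∧
      Set.range M'.mulVec = Set.range M.mulVec := by
  classical
  have : NeZero q := ⟨hq.ne'⟩
  set P : Set (Set (Fin d → ℤ)) := {S | ∃ M N : Matrix (Fin d) (Fin d) ℤ,
    M * N = (q : ℤ) • (1 : Matrix (Fin d) (Fin d) ℤ) ∧ Set.range M.mulVec = S} with hP
  let c : (Fin d → ℤ) → (Fin d → ZMod q) := fun x i => (x i : ZMod q)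
  have key : ∀ S ∈ P, ∀ x, c x ∈ c '' S → x ∈ S := by
    rintro S ⟨M, N, hMN, rfl⟩ x ⟨_, ⟨y, rfl⟩, hy⟩
    have hz : ∀ i, ∃ z : ℤ, x i = M.mulVec y i + q * z := by
      intro i
      have h1 : ((M.mulVec y i : ℤ) : ZMod q) = (x i : ZMod q) := congrFun hy i
      rw [ZMod.intCast_eq_intCast_iff_dvd_sub] at h1
      obtain ⟨z, hz⟩ := h1
      exact ⟨z, by linarith⟩
    choose z hz using hz
    refine ⟨y + N.mulVec z, ?_⟩
    rw [Matrix.mulVec_add, Matrix.mulVec_mulVec, hMN]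
    ext i
    simp [hz i]
  have hfin : P.Finite := by
    apply Set.Finite.of_finite_image (f := fun S => c '' S) (Set.toFinite _)
    intro S hS T hT hST
    simp only at hST
    ext x
    constructor
    · intro hx
      exact key T hT x (hST ▸ Set.mem_image_of_mem c hx)
    · intro hx
      exact key S hS x (hST.symm ▸ Set.mem_image_of_mem c hx)
  have hch : ∀ S : Set (Fin d → ℤ), ∃ M : Matrix (Fin d) (Fin d) ℤ,
      S ∈ P → Set.range M.mulVec = S := by
    intro S
    by_cases hS : S ∈ P
    · obtain ⟨M, N, _, h⟩ := hS
      exact ⟨M, fun _ => h⟩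
    · exact ⟨0, fun h => (hS h).elim⟩
  choose F hF using hch
  refine ⟨∑ S ∈ hfin.toFinset, ∑ i, ∑ j, |(F S i j : ℝ)|, by positivity, ?_⟩
  intro M N hMN
  have hS : Set.range M.mulVec ∈ P := ⟨M, N, hMN, rfl⟩
  refine ⟨F (Set.range M.mulVec), ?_, hF _ hS⟩
  intro i j
  set S := Set.range M.mulVec
  calc |(F S i j : ℝ)| ≤ ∑ j, |(F S i j : ℝ)| :=
        Finset.single_le_sum (f := fun j => |(F S i j : ℝ)|) (fun _ _ => by positivity)
          (Finset.mem_univ j)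
    _ ≤ ∑ i, ∑ j, |(F S i j : ℝ)| :=
        Finset.single_le_sum (f := fun i => ∑ j, |(F S i j : ℝ)|) (fun _ _ => by positivity)
          (Finset.mem_univ i)
    _ ≤ _ := Finset.single_le_sum (f := fun S => ∑ i, ∑ j, |(F S i j : ℝ)|)
          (fun _ _ => by positivity) (hfin.mem_toFinset.2 hS)

lemma exists_indep (d : ℕ) (m : ℝ) (hm : 0 < m) : ∃ R : ℝ, 0 ≤ R ∧
    ∀ B : Matrix (Fin d) (Fin d) ℝ, |B.det| = 1 →
    (∀ n : Fin d → ℤ, n ≠ 0 → ∃ i, m ≤ |B.mulVec (ivec n) i|) →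
    ∃ N : Matrix (Fin d) (Fin d) ℤ, N.det ≠ 0 ∧
      ∀ i j, |(B * N.map (fun z : ℤ => (z : ℝ))) i j| ≤ R := by
  classical
  set t : ℝ := m ^ d / 2 with ht
  have ht0 : 0 < t := by positivity
  refine ⟨m + |1 - t| / t * (d * m), by positivity, ?_⟩
  set R : ℝ := m + |1 - t| / t * (d * m) with hR
  intro B hB hmin
  set S : Set (Fin d → ℝ) := {v | (∃ n, B.mulVec (ivec n) = v) ∧ ∀ i, |v i| ≤ R} with hS
  have hB0 : B.det ≠ 0 := by
    intro h; simp [h] at hB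
  have hspan : Submodule.span ℝ S = ⊤ := by
    by_contra hne
    obtain ⟨f, hf0, hf⟩ := Submodule.exists_le_ker_of_lt_top _ (lt_top_iff_ne_top.2 hne)
    set u : Fin d → ℝ := fun i => f (Pi.single i 1) with hu
    have hfu : ∀ x, f x = u ⬝ᵥ x := by
      intro x
      rw [LinearMap.pi_apply_eq_sum_univ f x]
      simp [dotProduct, hu, mul_comm]
      apply Finset.sum_congr rfl
      intro i _
      congr 2
      ext j
      simp [Pi.single_apply, eq_comm]
    have hu0 : u ≠ 0 := by
      intro h
      apply hf0
      ext x
      simp [hfu, h]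
    have huu : 0 < u ⬝ᵥ u := by
      have h0 : 0 ≤ u ⬝ᵥ u := Finset.sum_nonneg fun i _ => mul_self_nonneg _
      exact lt_of_le_of_ne h0 fun h => hu0 (dotProduct_self_eq_zero.1 h.symm)
    set w : Fin d → ℝ := (Real.sqrt (u ⬝ᵥ u))⁻¹ • u with hw
    have hww : w ⬝ᵥ w = 1 := by
      rw [hw, smul_dotProduct, dotProduct_smul, smul_eq_mul, smul_eq_mul]
      have h1 := Real.mul_self_sqrt huu.le
      have h2 : Real.sqrt (u ⬝ᵥ u) ≠ 0 := (Real.sqrt_pos.2 huu).ne'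
      field_simp
      rw [pow_two, h1]
    have hwi : ∀ i, |w i| ≤ 1 := by
      intro i
      have h1 : w i * w i ≤ w ⬝ᵥ w :=
        Finset.single_le_sum (f := fun i => w i * w i) (fun _ _ => mul_self_nonneg _)
          (Finset.mem_univ i)
      rw [hww] at h1
      rw [← sq_le_one_iff_abs_le_one]
      nlinarith
    have hwS : ∀ x ∈ S, w ⬝ᵥ x = 0 := by
      intro x hx
      have h1 : f x = 0 := hf (Submodule.subset_span hx)
      rw [hw, smul_dotProduct, ← hfu x, h1, smul_zero]
    set T : Matrix (Fin d) (Fin d) ℝ := 1 + Matrix.replicateCol Unit ((t - 1) • w) *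
      Matrix.replicateRow Unit w with hT
    have hTdet : T.det = t := by
      rw [hT, Matrix.det_one_add_replicateCol_mul_replicateRow, dotProduct_smul, hww]
      simp
    have hTv : ∀ x i, T.mulVec x i = x i + (t - 1) * (w ⬝ᵥ x) * w i := by
      intro x i
      rw [hT, Matrix.add_mulVec, Matrix.one_mulVec, Pi.add_apply]
      congr 1
      simp only [Matrix.mulVec, dotProduct, Matrix.mul_apply, Matrix.replicateCol_apply,
        Matrix.replicateRow_apply, Finset.univ_unique, Finset.sum_singleton, Pi.smul_apply,
        smul_eq_mul]
      rw [Finset.mul_sum, Finset.sum_mul]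
      exact Finset.sum_congr rfl fun j _ => by ring
    set E : Matrix (Fin d) (Fin d) ℝ := m⁻¹ • (T * B) with hE
    have hEdet : |E.det| = 1 / 2 := by
      rw [hE, Matrix.det_smul, Matrix.det_mul, hTdet, abs_mul, abs_mul, hB, abs_of_pos ht0,
        abs_of_pos (by positivity), Fintype.card_fin, ht, inv_pow]
      field_simp
    obtain ⟨n, hn0, hn⟩ := mink (E := E) (by intro h; rw [h] at hEdet; norm_num at hEdet)
      (by rw [hEdet]; norm_num)
    set x := B.mulVec (ivec n) with hx
    have hy : ∀ i, |T.mulVec x i| < m := by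
      intro i
      have h1 := hn i
      rw [hE, Matrix.smul_mulVec, ← Matrix.mulVec_mulVec, Pi.smul_apply, smul_eq_mul, abs_mul,
        abs_of_pos (inv_pos.2 hm)] at h1
      rwa [inv_mul_lt_iff₀ hm, mul_one] at h1
    have hwy : w ⬝ᵥ T.mulVec x = t * (w ⬝ᵥ x) := by
      have : T.mulVec x = x + ((t - 1) * (w ⬝ᵥ x)) • w := by
        ext i; rw [hTv]; rfl
      rw [this, dotProduct_add, dotProduct_smul, hww, smul_eq_mul]
      ring
    have hwyle : |w ⬝ᵥ T.mulVec x| ≤ d * m := by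
      calc |w ⬝ᵥ T.mulVec x| ≤ ∑ i, |w i * T.mulVec x i| := Finset.abs_sum_le_sum_abs _ _
        _ ≤ ∑ i : Fin d, m := by
            apply Finset.sum_le_sum
            intro i _
            rw [abs_mul]
            have h1 := hwi i
            have h2 := (hy i).le
            calc |w i| * |T.mulVec x i| ≤ 1 * m := by gcongr
              _ = m := one_mul _
        _ = d * m := by simp
    have hxS : x ∈ S := by
      refine ⟨⟨n, rfl⟩, fun i => ?_⟩
      have h1 : x i = T.mulVec x i + (1 - t) / t * (w ⬝ᵥ T.mulVec x) * w i := by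
        rw [hwy, hTv]; field_simp; ring
      rw [h1]
      calc _ ≤ |T.mulVec x i| + |(1 - t) / t * (w ⬝ᵥ T.mulVec x) * w i| := abs_add_le _ _
        _ = |T.mulVec x i| + |1 - t| / t * |w ⬝ᵥ T.mulVec x| * |w i| := by
            rw [abs_mul, abs_mul, abs_div, abs_of_pos ht0]
        _ ≤ m + |1 - t| / t * (d * m) * 1 := by
            have h2 := hwi i
            have h3 := (hy i).le
            gcongr
        _ = R := by rw [mul_one]
    obtain ⟨i, hi⟩ := hmin n hn0
    have h1 := hy i
    rw [hTv, hwS x hxS] at h1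
    simp at h1
    linarith
  have hfr : Module.finrank ℝ (Submodule.span ℝ S) = d := by
    rw [hspan, finrank_top, Module.finrank_fin_fun]
  obtain ⟨g, hgS, -, hg⟩ := Submodule.exists_fun_fin_finrank_span_eq ℝ S
  set g' : Fin d → (Fin d → ℝ) := g ∘ Fin.cast hfr.symm with hg'
  have hg'i : LinearIndependent ℝ g' := hg.comp _ (Fin.cast_injective _)
  have hg'S : ∀ i, g' i ∈ S := fun i => hgS _
  choose n hn using fun i => (hg'S i).1
  have hBN : B * (Matrix.of fun i j => n j i : Matrix (Fin d) (Fin d) ℤ).map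
      (fun z : ℤ => (z : ℝ)) = (Matrix.of g').transpose := by
    ext i j
    have := congrFun (hn j) i
    simp only [Matrix.transpose_apply, Matrix.of_apply]
    rw [← this]
    simp [Matrix.mul_apply, Matrix.mulVec, dotProduct, ivec]
  refine ⟨Matrix.of fun i j => n j i, ?_, ?_⟩
  · intro h
    have h1 : ((Matrix.of fun i j => n j i : Matrix (Fin d) (Fin d) ℤ).map
      (fun z : ℤ => (z : ℝ))).det = 0 := by
      have := Int.cast_det (R := ℝ) (Matrix.of fun i j => n j i : Matrix (Fin d) (Fin d) ℤ)
      rw [h] at this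
      simpa using this.symm
    have h2 := congrArg Matrix.det hBN
    rw [Matrix.det_mul, h1, mul_zero, Matrix.det_transpose] at h2
    have h3 : IsUnit (Matrix.of g') := Matrix.linearIndependent_rows_iff_isUnit.1 hg'i
    rw [Matrix.isUnit_iff_isUnit_det, ← h2] at h3
    simp at h3
  · intro i j
    rw [hBN]
    exact (hg'S j).2 i

/-- integer matrix as a real matrix -/
def imat {d : ℕ} (N : Matrix (Fin d) (Fin d) ℤ) : Matrix (Fin d) (Fin d) ℝ :=
  N.map (fun z : ℤ => (z : ℝ))

lemma imat_mulVec {d : ℕ} (N : Matrix (Fin d) (Fin d) ℤ) (n : Fin d → ℤ) :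
    (imat N).mulVec (ivec n) = ivec (N.mulVec n) := by
  ext i
  simp [imat, ivec, Matrix.mulVec, dotProduct]

lemma imat_det {d : ℕ} (N : Matrix (Fin d) (Fin d) ℤ) : (imat N).det = (N.det : ℝ) :=
  (Int.cast_det (R := ℝ) N).symm

lemma exists_factor {d : ℕ} {A B : Matrix (Fin d) (Fin d) ℝ} (h : lat d A ⊆ lat d B) :
    ∃ P : Matrix (Fin d) (Fin d) ℤ, A = B * imat P := by
  classical
  have h1 : ∀ j, ∃ n : Fin d → ℤ, B.mulVec (ivec n) = fun i => A i j := by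
    intro j
    have h2 : pt A (Pi.single j 1) ∈ lat d B := h (by rw [lat_eq]; exact ⟨_, rfl⟩)
    rw [lat_eq] at h2
    obtain ⟨n, hn⟩ := h2
    refine ⟨n, ?_⟩
    have h3 : B.mulVec (ivec n) = A.mulVec (ivec (Pi.single j 1)) := WithLp.toLp_injective 2 hn
    rw [h3]
    have h4 : ivec (Pi.single j (1 : ℤ)) = Pi.single j (1 : ℝ) := by
      ext i
      by_cases hij : i = j
      · subst hij; simp [ivec]
      · simp [ivec, hij]
    rw [h4, Matrix.mulVec_single_one]
    rfl
  choose n hn using h1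
  refine ⟨Matrix.of fun i j => n j i, ?_⟩
  ext i j
  rw [← congrFun (hn j) i]
  simp [Matrix.mul_apply, Matrix.mulVec, dotProduct, ivec, imat]

lemma abs_det_eq {d : ℕ} {A B : Matrix (Fin d) (Fin d) ℝ} (hB : B.det ≠ 0)
    (h : lat d A = lat d B) : |A.det| = |B.det| := by
  obtain ⟨P, hP⟩ := exists_factor h.subset
  obtain ⟨Q, hQ⟩ := exists_factor h.symm.subset
  have h1 : A.det = B.det * P.det := by
    conv_lhs => rw [hP]
    rw [Matrix.det_mul, imat_det]
  have h2 : B.det = A.det * Q.det := by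
    conv_lhs => rw [hQ]
    rw [Matrix.det_mul, imat_det]
  have h3 : (P.det : ℝ) * Q.det = 1 := by
    apply mul_left_cancel₀ hB
    rw [mul_one, ← mul_assoc, ← h1, ← h2]
  have h4 : P.det * Q.det = 1 := by exact_mod_cast h3
  rcases Int.eq_one_or_neg_one_of_mul_eq_one h4 with h5 | h5 <;> simp [h1, h5]

lemma reduce (d : ℕ) (m : ℝ) (hm : 0 < m) : ∃ R : ℝ,
    ∀ B : Matrix (Fin d) (Fin d) ℝ, |B.det| = 1 →
    (∀ n : Fin d → ℤ, n ≠ 0 → ∃ i, m ≤ |B.mulVec (ivec n) i|) →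
    ∃ A : Matrix (Fin d) (Fin d) ℝ, |A.det| = 1 ∧ (∀ i j, |A i j| ≤ R) ∧ lat d A = lat d B := by
  classical
  obtain ⟨R₁, hR₁, H⟩ := exists_indep d m hm
  choose f hf0 hf using fun q : ℕ => fin_rep d (q + 1) q.succ_pos
  set K : ℕ := ⌊(d.factorial : ℝ) * R₁ ^ d⌋₊ with hK
  set R₂ : ℝ := ∑ q ∈ Finset.range (K + 1), f q with hR₂
  have hR₂0 : 0 ≤ R₂ := Finset.sum_nonneg fun q _ => hf0 q
  refine ⟨d * (R₁ * R₂), ?_⟩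
  intro B hB hmin
  have hB0 : B.det ≠ 0 := by
    intro h; simp [h] at hB
  obtain ⟨N, hN0, hN⟩ := H B hB hmin
  change ∀ i j, |(B * imat N) i j| ≤ R₁ at hN
  obtain ⟨q, hq⟩ : ∃ q : ℕ, N.det.natAbs = q + 1 :=
    Nat.exists_eq_succ_of_ne_zero (Int.natAbs_ne_zero.2 hN0)
  have habs : |N.det| = ((q + 1 : ℕ) : ℤ) := by rw [← hq, Int.natCast_natAbs]
  have hqK : q + 1 ≤ K := by
    apply Nat.le_floor
    have h1 := Matrix.det_le (A := B * imat N) (abv := AbsoluteValue.abs) (x := R₁) hN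
    rw [Matrix.det_mul, imat_det] at h1
    simp only [AbsoluteValue.abs_apply, abs_mul, hB, one_mul, Fintype.card_fin,
      nsmul_eq_mul] at h1
    have h2 : |(N.det : ℝ)| = ((q + 1 : ℕ) : ℝ) := by exact_mod_cast habs
    rwa [h2] at h1
  obtain ⟨M, hMb, hMr⟩ := hf q N.adjugate (N.det.sign • N) (by
    rw [Matrix.mul_smul, Matrix.adjugate_mul, smul_smul, Int.sign_mul_self_eq_abs, habs])
  have hfq : f q ≤ R₂ := Finset.single_le_sum (f := f) (fun q _ => hf0 q)
    (Finset.mem_range.2 (by omega))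
  set Q : ℝ := ((q + 1 : ℕ) : ℝ) with hQ
  have hQ1 : 1 ≤ Q := by simp [hQ]
  set A : Matrix (Fin d) (Fin d) ℝ := Q⁻¹ • ((B * imat N) * imat M) with hA
  have key : ∀ n y : Fin d → ℤ, M.mulVec n = N.adjugate.mulVec y →
      pt A n = pt B (N.det.sign • y) := by
    intro n y h
    have h1 : A.mulVec (ivec n) = B.mulVec (ivec (N.det.sign • y)) := by
      rw [hA, Matrix.smul_mulVec, ← Matrix.mulVec_mulVec, ← Matrix.mulVec_mulVec, imat_mulVec, h,
        imat_mulVec, Matrix.mulVec_mulVec, Matrix.mul_adjugate, ← Matrix.mulVec_smul]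
      congr 1
      ext j
      have h2 : (N.det : ℝ) = N.det.sign * Q := by
        have h3 : N.det = N.det.sign * ((q + 1 : ℕ) : ℤ) := by
          rw [← habs, Int.sign_mul_abs]
        rw [hQ]
        exact_mod_cast congrArg (Int.cast : ℤ → ℝ) h3
      simp only [Matrix.smul_mulVec, Matrix.one_mulVec, ivec, Pi.smul_apply, smul_eq_mul,
        Int.cast_mul, h2]
      field_simp
    rw [pt, h1]; rfl
  have hsign : N.det.sign * N.det.sign = 1 := by
    rcases lt_or_gt_of_ne hN0 with h | h
    · simp [Int.sign_eq_neg_one_of_neg h]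
    · simp [Int.sign_eq_one_of_pos h]
  have hlat : lat d A = lat d B := by
    rw [lat_eq, lat_eq]
    apply Set.Subset.antisymm
    · rintro _ ⟨n, rfl⟩
      have h1 : M.mulVec n ∈ Set.range N.adjugate.mulVec := hMr ▸ ⟨n, rfl⟩
      obtain ⟨y, hy⟩ := h1
      exact ⟨_, (key n y hy.symm).symm⟩
    · rintro _ ⟨y, rfl⟩
      have h1 : N.adjugate.mulVec (N.det.sign • y) ∈ Set.range M.mulVec := hMr ▸ ⟨_, rfl⟩
      obtain ⟨n, hn⟩ := h1
      refine ⟨n, ?_⟩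
      rw [key n _ hn, smul_smul, hsign, one_smul]
  refine ⟨A, by rw [abs_det_eq hB0 hlat, hB], ?_, hlat⟩
  intro i j
  rw [hA, Matrix.smul_apply, smul_eq_mul, abs_mul, abs_of_pos (by positivity)]
  have h1 : |((B * imat N) * imat M) i j| ≤ d * (R₁ * R₂) := by
    rw [Matrix.mul_apply]
    calc _ ≤ ∑ l, |(B * imat N) i l * imat M l j| := Finset.abs_sum_le_sum_abs _ _
      _ ≤ ∑ l : Fin d, R₁ * R₂ := by
          apply Finset.sum_le_sum
          intro l _
          rw [abs_mul]
          have h2 := hN i l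
          have h3 : |imat M l j| ≤ R₂ := (hMb l j).trans hfq
          gcongr
      _ = _ := by simp
  calc _ ≤ 1 * (d * (R₁ * R₂)) := by
        gcongr
        exact inv_le_one_of_one_le₀ hQ1
    _ = _ := one_mul _

/-- For any `d ≥ 1` and `k ≥ 1`, the supremum of `Λ̃_k` over all
full-rank lattices in `ℝ^d` is attained by some lattice of covolume 1. -/
theorem stmt_0 (d k : ℕ) (hd : 1 ≤ d) (hk : 1 ≤ k) :
    ∃ A : Matrix (Fin d) (Fin d) ℝ, |A.det| = 1 ∧
      ∀ B : Matrix (Fin d) (Fin d) ℝ, B.det ≠ 0 → Lam d B k ≤ Lam d A k := by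
  have hd0 : (0 : ℝ) < d := by exact_mod_cast hd
  have hk0 : (0 : ℝ) < k := by exact_mod_cast hk
  set m : ℝ := 1 / (2 * k * d) with hm
  have hm0 : 0 < m := by positivity
  obtain ⟨R, hR⟩ := reduce d m hm0
  set S : Set (Matrix (Fin d) (Fin d) ℝ) := {A | |A.det| = 1 ∧ ∀ i j, |A i j| ≤ R} with hS
  have hred : ∀ B : Matrix (Fin d) (Fin d) ℝ, |B.det| = 1 → 1 ≤ gammaNorm d B k →
      ∃ A ∈ S, gammaNorm d A k = gammaNorm d B k := by
    intro B hB hg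
    have hB0 : B.det ≠ 0 := by
      intro h; simp [h] at hB
    obtain ⟨A, h1, h2, h3⟩ := hR B hB (by
      intro n hn
      by_contra! hlt
      have h1 := norm_le_of_coord (pt B n) hm0.le fun i => (hlt i).le
      have h2 := hg.trans (gammaNorm_le_mul (k := k) hB0 hn)
      have h3 : (k : ℝ) * ‖pt B n‖ ≤ k * (d * m) := by gcongr
      have h4 : (k : ℝ) * (d * m) = 1 / 2 := by rw [hm]; field_simp
      linarith)
    refine ⟨A, ⟨h1, h2⟩, ?_⟩
    unfold gammaNorm
    rw [h3]
  have hone := one_le_gammaNorm_one hd hk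
  obtain ⟨A₁, hA₁, hgA₁⟩ := hred 1 (by simp) hone
  have hcomp : IsCompact S := by
    have hK : IsCompact (Set.univ.pi fun _ : Fin d => Set.univ.pi fun _ : Fin d =>
        Set.Icc (-R) R) := isCompact_univ_pi fun _ => isCompact_univ_pi fun _ => isCompact_Icc
    refine IsCompact.of_isClosed_subset (X := Matrix (Fin d) (Fin d) ℝ) hK ?_ ?_
    · refine IsClosed.inter (isClosed_eq (by fun_prop) continuous_const) ?_
      change IsClosed {A : Matrix (Fin d) (Fin d) ℝ | ∀ i j, |A i j| ≤ R}
      simp only [Set.ofPred_forall]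
      refine isClosed_iInter fun i => isClosed_iInter fun j => isClosed_le ?_ continuous_const
      fun_prop
    · intro A hA i _ j _
      exact abs_le.1 (hA.2 i j)
  have hS0 : ∀ A ∈ S, A.det ≠ 0 := by
    intro A hA h
    have := hA.1
    simp [h] at this
  obtain ⟨A, hAS, hmax⟩ := (usc (k := k) hd S hS0).exists_isMaxOn ⟨A₁, hA₁⟩ hcomp
  refine ⟨A, hAS.1, ?_⟩
  have hLA : Lam d A k = gammaNorm d A k := by simp [Lam, hAS.1]
  intro B hB
  rw [hLA, Lam]
  set c : ℝ := |B.det| ^ (-(1 : ℝ) / d) with hc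
  have hBp : 0 < |B.det| := abs_pos.2 hB
  have hc0 : 0 < c := Real.rpow_pos_of_pos hBp _
  refine (gammaNorm_smul hd hB hc0).trans ?_
  have hdet : |(c • B).det| = 1 := by
    rw [Matrix.det_smul, abs_mul, Fintype.card_fin, abs_of_pos (pow_pos hc0 d), hc,
      ← Real.rpow_natCast, ← Real.rpow_mul hBp.le, div_mul_cancel₀ _ hd0.ne', Real.rpow_neg_one,
      inv_mul_cancel₀ hBp.ne']
  by_cases hg : 1 ≤ gammaNorm d (c • B) k
  · obtain ⟨A', hA', h⟩ := hred _ hdet hg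
    rw [← h]
    exact hmax hA'
  · have h1 : gammaNorm d A₁ k ≤ gammaNorm d A k := hmax hA₁
    rw [not_le] at hg
    linarith
end
end

section
/- Let d be an integer with 2 ≤ d ≤ 10. There exist a constant c > 0 and K ∈ ℕ such that for every k ≥ K, every full-rank lattice Γ ⊂ ℝ^d with covolume |Γ| = 1 that maximises Λ̃_{2k} (i.e. Λ̃_{2k}(Γ) ≥ Λ̃_{2k}(Γ′) for every full-rank lattice Γ′ ⊂ ℝ^d) satisfies μ_d(Γ) ≥ c k^{1/d}. -/
open scoped RealInnerProductSpace
open MeasureTheory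

noncomputable section

/-- The `j`-th successive minimum of the lattice `A ℤ^d`:
`μ_j(Γ) = inf {μ > 0 : the points of Γ of norm ≤ μ span a subspace of dimension ≥ j}`. -/
def mu (d : ℕ) (A : Matrix (Fin d) (Fin d) ℝ) (j : ℕ) : ℝ :=
  sInf {μ : ℝ | 0 < μ ∧
    j ≤ Module.finrank ℝ (Submodule.span ℝ {γ ∈ lat d A | ‖γ‖ ≤ μ})}

theorem aux_basis (d : ℕ) (A : Matrix (Fin d) (Fin d) ℝ) (hA : A.det ≠ 0) :
    ∃ b : Module.Basis (Fin d) ℝ (EuclideanSpace ℝ (Fin d)), (∀ j i, b j i = A i j) ∧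
      lat d A = (Submodule.span ℤ (Set.range b) : Set (EuclideanSpace ℝ (Fin d))) ∧
      volume (ZSpan.fundamentalDomain b) = ENNReal.ofReal |A.det| := by
  have hu : IsUnit A.det := isUnit_iff_ne_zero.mpr hA
  have : Invertible A := A.invertibleOfIsUnitDet hu
  let b := (Pi.basisFun ℝ (Fin d)).map
    ((Matrix.toLin'OfInv (M := A⁻¹) (M' := A) (A.nonsing_inv_mul hu) (A.mul_nonsing_inv hu)).trans
      (WithLp.linearEquiv 2 ℝ (Fin d → ℝ)).symm)
  have hb : ∀ j i, b j i = A i j := by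
    intro j i
    simp [b]
  refine ⟨b, hb, ?_, ?_⟩
  · ext x
    simp only [lat, Set.mem_ofPred_eq, SetLike.mem_coe]
    rw [Submodule.mem_span_range_iff_exists_fun]
    refine exists_congr fun n => ?_
    constructor
    · intro h
      ext i
      simp [h, hb, mul_comm]
    · rintro rfl i
      simp [hb, mul_comm]
  · let b₀ := (EuclideanSpace.basisFun (Fin d) ℝ).toBasis
    rw [ZSpan.measure_fundamentalDomain b volume b₀]
    have h1 : volume (ZSpan.fundamentalDomain b₀) = 1 := by
      rw [measure_congr (ZSpan.fundamentalDomain_ae_parallelepiped b₀ volume)]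
      exact (EuclideanSpace.basisFun (Fin d) ℝ).volume_parallelepiped
    have h2 : b₀.det b = A.det := by
      rw [Module.Basis.det_apply]
      congr 1
      ext i j
      simp [Module.Basis.toMatrix_apply, b₀, hb]
    rw [h1, h2, mul_one]

theorem aux_ball (d : ℕ) (hd2 : 2 ≤ d) (hd10 : d ≤ 10) (ρ : ℝ) (hρ : 0 ≤ ρ) :
    ENNReal.ofReal (2.02 * ρ ^ d) ≤
      volume (Metric.closedBall (0 : EuclideanSpace ℝ (Fin d)) ρ) := by
  have hpi := Real.pi_gt_three
  have h2 : (3:ℝ) ^ 2 ≤ Real.pi ^ 2 := by gcongr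
  have h3 : (3:ℝ) ^ 3 ≤ Real.pi ^ 3 := by gcongr
  have h4 : (3:ℝ) ^ 4 ≤ Real.pi ^ 4 := by gcongr
  have h5 : (3:ℝ) ^ 5 ≤ Real.pi ^ 5 := by gcongr
  obtain ⟨k, hk | hk⟩ := d.even_or_odd'
  · subst hk
    have : Nontrivial (EuclideanSpace ℝ (Fin (2 * k))) :=
      Module.nontrivial_of_finrank_pos (R := ℝ) (by simp; omega)
    rw [InnerProductSpace.volume_closedBall_of_dim_even (k := k) (by simp),
      finrank_euclideanSpace_fin, ← ENNReal.ofReal_pow hρ, ← ENNReal.ofReal_mul (by positivity)]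
    apply ENNReal.ofReal_le_ofReal
    rw [mul_comm]
    gcongr
    have : 1 ≤ k := by omega
    have : k ≤ 5 := by omega
    interval_cases k <;> simp [Nat.factorial] <;> linarith
  · subst hk
    rw [InnerProductSpace.volume_closedBall_of_dim_odd (k := k) (by simp),
      finrank_euclideanSpace_fin, ← ENNReal.ofReal_pow hρ, ← ENNReal.ofReal_mul (by positivity)]
    apply ENNReal.ofReal_le_ofReal
    rw [mul_comm]
    gcongr
    have : 1 ≤ k := by omega
    have : k ≤ 4 := by omega
    interval_cases k <;> simp [Nat.doubleFactorial] <;> linarith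

open scoped Pointwise in
theorem aux_count {d : ℕ} {ι : Type*} [Fintype ι]
    (b : Module.Basis (Fin d) ℝ (EuclideanSpace ℝ (Fin d)))
    (hv : volume (ZSpan.fundamentalDomain b) = 1)
    (w : Module.Basis ι ℝ (EuclideanSpace ℝ (Fin d))) (m ρ : ℝ)
    (hw : ∀ i, w i ∈ Submodule.span ℤ (Set.range b)) (hm : ∑ i, ‖w i‖ ≤ m) :
    volume (Metric.closedBall (0 : EuclideanSpace ℝ (Fin d)) ρ) ≤
      (({γ ∈ (Submodule.span ℤ (Set.range b) : Set (EuclideanSpace ℝ (Fin d))) |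
        ‖γ‖ ≤ ρ + m}).ncard : ENNReal) := by
  classical
  set L := Submodule.span ℤ (Set.range b) with hL
  set S := {γ ∈ (L : Set (EuclideanSpace ℝ (Fin d))) | ‖γ‖ ≤ ρ + m} with hS
  have hfin : S.Finite := by
    have := ZSpan.setFinite_inter b (s := Metric.closedBall 0 (ρ + m)) Metric.isBounded_closedBall
    refine this.subset ?_
    rintro x ⟨hx, hx2⟩
    exact ⟨by simpa using hx2, hx⟩
  have hF := ZSpan.isAddFundamentalDomain b (volume : Measure (EuclideanSpace ℝ (Fin d)))
  set B := Metric.closedBall (0 : EuclideanSpace ℝ (Fin d)) ρ with hB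
  have hBm : MeasurableSet B := Metric.isClosed_closedBall.measurableSet
  have hgm : ∀ g : L, MeasurableSet (g +ᵥ B) := fun g => hBm.const_vadd g
  have : Countable L := inferInstance
  have : VAddInvariantMeasure (Submodule.span ℤ (Set.range b)) (EuclideanSpace ℝ (Fin d))
      volume := inferInstanceAs <|
    VAddInvariantMeasure (Submodule.span ℤ (Set.range b)).toAddSubgroup
      (EuclideanSpace ℝ (Fin d)) volume
  rw [hF.measure_eq_tsum B]
  have e1 : ∀ g : L, volume ((g +ᵥ B) ∩ ZSpan.fundamentalDomain b) =
      ∫⁻ x in ZSpan.fundamentalDomain b, (g +ᵥ B).indicator 1 x := by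
    intro g
    rw [lintegral_indicator_one (hgm g), Measure.restrict_apply (hgm g)]
  simp_rw [e1]
  rw [← lintegral_tsum (fun g => (measurable_one.indicator (hgm g)).aemeasurable)]
  have key : ∀ x : EuclideanSpace ℝ (Fin d),
      ∑' g : L, (g +ᵥ B).indicator (1 : EuclideanSpace ℝ (Fin d) → ENNReal) x ≤ (S.ncard : ENNReal) := by
    intro x
    have hfl : ((ZSpan.floor w x : EuclideanSpace ℝ (Fin d))) ∈ L := by
      have h1 : Submodule.span ℤ (Set.range w) ≤ L := by
        rw [Submodule.span_le]
        rintro _ ⟨i, rfl⟩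
        exact hw i
      exact h1 (ZSpan.floor w x).2
    set f : EuclideanSpace ℝ (Fin d) := (ZSpan.floor w x : EuclideanSpace ℝ (Fin d)) with hf
    have hfr : ‖x - f‖ ≤ m := (ZSpan.norm_fract_le w x).trans hm
    let T : Set L := {g | x ∈ g +ᵥ B}
    have hT : ∀ g ∈ T, f - (g : EuclideanSpace ℝ (Fin d)) ∈ S := by
      intro g hg
      refine ⟨L.sub_mem hfl g.2, ?_⟩
      have h2 : ‖x - g‖ ≤ ρ := by
        obtain ⟨y, hy, hyx⟩ := hg
        have : x = (g : EuclideanSpace ℝ (Fin d)) + y := hyx.symm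
        rw [this]
        simpa [hB] using hy
      calc ‖f - (g : EuclideanSpace ℝ (Fin d))‖ = ‖(x - g) - (x - f)‖ := by congr 1; abel
        _ ≤ ‖x - g‖ + ‖x - f‖ := norm_sub_le _ _
        _ ≤ ρ + m := by gcongr
    have h3 : T.encard ≤ S.encard :=
      Set.encard_le_encard_of_injOn hT (fun g _ g' _ h => by
        apply Subtype.ext
        simpa using h)
    have h4 : ∑' g : L, (g +ᵥ B).indicator (1 : EuclideanSpace ℝ (Fin d) → ENNReal) x = (T.encard : ENNReal) := by
      rw [← ENNReal.tsum_set_one, tsum_subtype T (fun _ => (1 : ENNReal))]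
      refine tsum_congr fun g => ?_
      by_cases hg : x ∈ g +ᵥ B
      · rw [Set.indicator_of_mem hg, Set.indicator_of_mem (show g ∈ T from hg), Pi.one_apply]
      · rw [Set.indicator_of_notMem hg, Set.indicator_of_notMem (show g ∉ T from hg)]
    rw [h4, ← ENat.toENNReal_coe, hfin.cast_ncard_eq]
    exact ENat.toENNReal_le.mpr h3
  calc _ ≤ ∫⁻ x in ZSpan.fundamentalDomain b, (S.ncard : ENNReal) := lintegral_mono key
    _ = S.ncard := by rw [setLIntegral_const, hv, mul_one]

theorem aux_finite (d : ℕ) (A : Matrix (Fin d) (Fin d) ℝ) (hA : A.det ≠ 0) (r : ℝ) :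
    ({γ ∈ lat d A | ‖γ‖ ≤ r}).Finite := by
  obtain ⟨b, hb, hL, hv⟩ := aux_basis d A hA
  have := ZSpan.setFinite_inter b (s := Metric.closedBall 0 r) Metric.isBounded_closedBall
  refine this.subset ?_
  rintro x ⟨hx, hx2⟩
  exact ⟨by simpa using hx2, by rwa [hL] at hx⟩

theorem aux_nonempty (d : ℕ) (hd : 0 < d) (A : Matrix (Fin d) (Fin d) ℝ) (hA : A.det ≠ 0)
    (k : ℕ) : {r : ℝ | 0 ≤ r ∧ k + 1 ≤ ({γ ∈ lat d A | ‖γ‖ ≤ r}).ncard}.Nonempty := by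
  obtain ⟨b, hb, hL, hv⟩ := aux_basis d A hA
  let v := b ⟨0, hd⟩
  have hv0 : v ≠ 0 := b.ne_zero _
  refine ⟨k * ‖v‖, by positivity, ?_⟩
  have hsub : (fun n : ℕ => (n : ℝ) • v) '' (Finset.range (k + 1) : Set ℕ) ⊆
      {γ ∈ lat d A | ‖γ‖ ≤ k * ‖v‖} := by
    rintro _ ⟨n, hn, rfl⟩
    refine ⟨?_, ?_⟩
    · simp only [hL, Nat.cast_smul_eq_nsmul]
      exact Submodule.smul_of_tower_mem _ n (Submodule.subset_span ⟨_, rfl⟩)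
    · simp only [norm_smul, Real.norm_natCast]
      have : n ≤ k := by simpa [Nat.lt_succ_iff] using hn
      gcongr
  have := Set.ncard_le_ncard hsub (aux_finite d A hA _)
  rw [Set.ncard_image_of_injective, Set.ncard_coe_finset, Finset.card_range] at this
  · exact this
  · intro a c h
    exact_mod_cast smul_left_injective ℝ hv0 h

theorem aux_lower (d : ℕ) (hd : 0 < d) (k : ℕ) (s : ℝ) (hs : 0 < s) (hsk : s ^ d = k) :
    ∃ B : Matrix (Fin d) (Fin d) ℝ, B.det = 1 ∧ s ≤ gammaNorm d B (2 * k) := by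
  obtain ⟨n, rfl⟩ : ∃ n, d = n + 1 := ⟨d - 1, by omega⟩
  let v : Fin (n + 1) → ℝ := Fin.cons ((s ^ n)⁻¹) (fun _ => s)
  have hdet : (Matrix.diagonal v).det = 1 := by
    rw [Matrix.det_diagonal, Fin.prod_univ_succ]
    simp [v]
    field_simp
  refine ⟨Matrix.diagonal v, hdet, ?_⟩
  refine le_csInf (aux_nonempty _ hd _ (by rw [hdet]; exact one_ne_zero) _) ?_
  rintro r ⟨hr, hc⟩
  by_contra! hrs
  let φ : ℤ → EuclideanSpace ℝ (Fin (n + 1)) := fun m =>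
    WithLp.toLp 2 (Fin.cons ((s ^ n)⁻¹ * m) (fun _ => 0) : Fin (n + 1) → ℝ)
  have hsub : {γ ∈ lat (n + 1) (Matrix.diagonal v) | ‖γ‖ ≤ r} ⊆
      φ '' (Finset.Ioo (-(k : ℤ)) k : Set ℤ) := by
    rintro x ⟨⟨m, hm⟩, hx⟩
    have hm' : ∀ i, x i = v i * m i := by
      intro i
      rw [hm, Finset.sum_eq_single i] <;> simp +contextual [Matrix.diagonal_apply]
      intro j hj h; exact absurd h.symm hj
    have hlt : ∀ i, |v i * m i| < s := by
      intro i
      rw [← hm' i]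
      exact ((PiLp.norm_apply_le x i).trans hx).trans_lt hrs
    have hz : ∀ i : Fin n, m i.succ = 0 := by
      intro i
      have := hlt i.succ
      simp only [v, Fin.cons_succ, abs_mul, abs_of_pos hs] at this
      have h1 : |(m i.succ : ℝ)| < 1 := by
        by_contra! h
        nlinarith
      have h2 : |m i.succ| < 1 := by exact_mod_cast h1
      exact Int.abs_lt_one_iff.mp h2
    refine ⟨m 0, ?_, ?_⟩
    · have h0 := hlt 0
      have hp : 0 < s ^ n := by positivity
      simp only [v, Fin.cons_zero, abs_mul, abs_inv, abs_of_pos hp] at h0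
      rw [inv_mul_lt_iff₀ hp, ← pow_succ, hsk] at h0
      have h1 : |m 0| < (k : ℤ) := by exact_mod_cast h0
      rw [abs_lt] at h1
      simpa using h1
    · ext i
      rw [hm' i]
      refine Fin.cases ?_ (fun j => ?_) i
      · simp [φ, v]
      · simp [φ, v, hz]
  have h1 := Set.ncard_le_ncard hsub (Set.toFinite _)
  have h2 := h1.trans (Set.ncard_image_le (Set.toFinite _))
  rw [Set.ncard_coe_finset, Int.card_Ioo] at h2
  omega

theorem aux_mu (d : ℕ) (A : Matrix (Fin d) (Fin d) ℝ) (hA : A.det ≠ 0) (t : ℝ)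
    (ht : mu d A d < t) :
    ∃ (ι : Type) (_ : Fintype ι) (w : Module.Basis ι ℝ (EuclideanSpace ℝ (Fin d))),
      (∀ i, w i ∈ lat d A) ∧ ∑ i, ‖w i‖ ≤ d * t := by
  obtain ⟨b, hb, hL, hv⟩ := aux_basis d A hA
  have hne : {μ : ℝ | 0 < μ ∧
    d ≤ Module.finrank ℝ (Submodule.span ℝ {γ ∈ lat d A | ‖γ‖ ≤ μ})}.Nonempty := by
    refine ⟨1 + ∑ i, ‖b i‖, by positivity, ?_⟩
    have : Submodule.span ℝ {γ ∈ lat d A | ‖γ‖ ≤ 1 + ∑ i, ‖b i‖} = ⊤ := by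
      rw [eq_top_iff, ← b.span_eq]
      apply Submodule.span_mono
      rintro _ ⟨i, rfl⟩
      refine ⟨by rw [hL]; exact Submodule.subset_span ⟨i, rfl⟩, ?_⟩
      have := Finset.single_le_sum (f := fun i => ‖b i‖) (fun i _ => norm_nonneg _)
        (Finset.mem_univ i)
      linarith
    rw [this]
    simp
  obtain ⟨m, ⟨hm0, hm⟩, hmt⟩ := exists_lt_of_csInf_lt hne ht
  have htop : Submodule.span ℝ {γ ∈ lat d A | ‖γ‖ ≤ m} = ⊤ := by
    apply Submodule.eq_top_of_finrank_eq
    apply le_antisymm (Submodule.finrank_le _)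
    simpa using hm
  let w := Module.Basis.ofSpan (K := ℝ) htop.ge
  have hw := Module.Basis.ofSpan_subset (K := ℝ) htop.ge
  let e := w.reindex (w.indexEquiv b)
  have he : ∀ i, e i ∈ {γ ∈ lat d A | ‖γ‖ ≤ m} := by
    intro i
    simp only [e, Module.Basis.reindex_apply]
    exact hw ⟨_, rfl⟩
  refine ⟨Fin d, inferInstance, e, fun i => (he i).1, ?_⟩
  calc ∑ i, ‖e i‖ ≤ ∑ i : Fin d, t := Finset.sum_le_sum fun i _ => (he i).2.trans hmt.le
    _ = d * t := by simp

/-- For `2 ≤ d ≤ 10` there are `c > 0` and `K` such that for all `k ≥ K`,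
any unit-covolume lattice maximising `Λ̃_{2k}` has last successive minimum `μ_d ≥ c k^{1/d}`. -/
theorem stmt_1 (d : ℕ) (hd2 : 2 ≤ d) (hd10 : d ≤ 10) :
    ∃ c > (0 : ℝ), ∃ K : ℕ, ∀ k : ℕ, K ≤ k →
      ∀ A : Matrix (Fin d) (Fin d) ℝ, |A.det| = 1 →
        (∀ B : Matrix (Fin d) (Fin d) ℝ, B.det ≠ 0 → Lam d B (2 * k) ≤ Lam d A (2 * k)) →
        c * (k : ℝ) ^ ((1 : ℝ) / d) ≤ mu d A d := by
  have hd0 : 0 < d := by omega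
  refine ⟨1 / 100000, by norm_num, 1, fun k hk A hdA hmax => ?_⟩
  have hA : A.det ≠ 0 := by
    intro h
    simp [h] at hdA
  by_contra! hlt
  set R : ℝ := (k : ℝ) ^ ((1 : ℝ) / d) with hR
  have hk0 : (0 : ℝ) < k := by exact_mod_cast hk
  have hR0 : 0 < R := by positivity
  have hRk : R ^ d = k := by
    rw [hR, one_div, Real.rpow_inv_natCast_pow hk0.le (by omega)]
  obtain ⟨B, hB, hBs⟩ := aux_lower d hd0 k R hR0 hRk
  have h1 := hmax B (by rw [hB]; exact one_ne_zero)
  simp only [Lam, hB, hdA, abs_one, Real.one_rpow, one_mul] at h1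
  have h2 : R ≤ gammaNorm d A (2 * k) := hBs.trans h1
  obtain ⟨b, hb, hL, hv⟩ := aux_basis d A hA
  obtain ⟨ι, _, w, hw, hws⟩ := aux_mu d A hA _ hlt
  rw [hdA, ENNReal.ofReal_one] at hv
  have hd10' : (d : ℝ) ≤ 10 := by exact_mod_cast hd10
  have hms : ∑ i, ‖w i‖ ≤ R / 10000 := by
    refine hws.trans ?_
    nlinarith
  have hc := aux_count b hv w (R / 10000) (R * (1 - 2 / 10000))
    (fun i => by have := hw i; rwa [hL] at this) hms
  have hc2 := (aux_ball d hd2 hd10 (R * (1 - 2 / 10000)) (by nlinarith)).trans hc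
  rw [← hL, ENNReal.ofReal_le_natCast, mul_pow, hRk] at hc2
  have hpow : ((1 : ℝ) - 2 / 10000) ^ 10 ≤ (1 - 2 / 10000) ^ d :=
    pow_le_pow_of_le_one (by norm_num) (by norm_num) hd10
  have hpow2 : (0.995 : ℝ) ≤ (1 - 2 / 10000) ^ d := le_trans (by norm_num) hpow
  have hlt2 : ((2 * k : ℕ) : ℝ) < ({γ ∈ lat d A | ‖γ‖ ≤ R * (1 - 2 / 10000) + R / 10000}).ncard := by
    refine lt_of_lt_of_le ?_ hc2
    push_cast
    nlinarith
  have hlt3 : 2 * k < ({γ ∈ lat d A | ‖γ‖ ≤ R * (1 - 2 / 10000) + R / 10000}).ncard := by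
    exact_mod_cast hlt2
  have h3 : gammaNorm d A (2 * k) ≤ R * (1 - 2 / 10000) + R / 10000 :=
    csInf_le ⟨0, fun r hr => hr.1⟩ ⟨by nlinarith, hlt3⟩
  nlinarith
end
end

section
/- For every integer k ≥ 1 there exist a⋆, b⋆ > 0 with a⋆ b⋆ = 2 such that λ_k(a⋆, b⋆) ≥ λ_k(a, b) for all a, b > 0 with ab = 2; that is, the k-th Laplace eigenvalue of the flat Klein bottle is maximised among unit-volume flat Klein bottles. -/
noncomputable section

/-- The `k`-th Laplace eigenvalue of the flat Klein bottle `K(a,b)`: the eigenvalues,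
with multiplicity, are `4π²(m²/a² + n²/b²)` for `(m,n)` in the index set
`I = {(m,n) : n ≥ 1} ∪ {(m,0) : m even}`, and
`λ_k = inf {t ≥ 0 : #{(m,n) ∈ I : 4π²(m²/a² + n²/b²) ≤ t} ≥ k + 1}`. -/
def kleinEig (a b : ℝ) (k : ℕ) : ℝ :=
  sInf {t : ℝ | 0 ≤ t ∧ k + 1 ≤
    ({p : ℤ × ℤ | (1 ≤ p.2 ∨ (p.2 = 0 ∧ Even p.1)) ∧
      4 * Real.pi ^ 2 * ((p.1 : ℝ) ^ 2 / a ^ 2 + (p.2 : ℝ) ^ 2 / b ^ 2) ≤ t}).ncard}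

def kbSet (a b t : ℝ) : Set (ℤ × ℤ) :=
  {p : ℤ × ℤ | (1 ≤ p.2 ∨ (p.2 = 0 ∧ Even p.1)) ∧
      4 * Real.pi ^ 2 * ((p.1 : ℝ) ^ 2 / a ^ 2 + (p.2 : ℝ) ^ 2 / b ^ 2) ≤ t}

lemma int_bound (m : ℤ) (X : ℝ) (h : (m : ℝ) ^ 2 ≤ X) : -⌈X⌉ ≤ m ∧ m ≤ ⌈X⌉ := by
  have h1 : |m| ≤ m ^ 2 := by
    rw [← sq_abs]
    nlinarith [abs_nonneg m, Int.le_self_sq |m|]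
  have h2 : ((m ^ 2 : ℤ) : ℝ) ≤ (⌈X⌉ : ℝ) := by
    push_cast
    exact h.trans (Int.le_ceil X)
  have h3 : m ^ 2 ≤ ⌈X⌉ := by exact_mod_cast h2
  exact abs_le.mp (h1.trans h3)

lemma kbSet_finite (a b t : ℝ) (ha : 0 < a) (hb : 0 < b) : (kbSet a b t).Finite := by
  apply Set.Finite.subset
    ((Set.finite_Icc (-⌈t * a ^ 2⌉) ⌈t * a ^ 2⌉).prod (Set.finite_Icc (-⌈t * b ^ 2⌉) ⌈t * b ^ 2⌉))
  rintro ⟨m, n⟩ ⟨-, h⟩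
  simp only at h
  have hpi : 1 ≤ 4 * Real.pi ^ 2 := by nlinarith [Real.pi_gt_three]
  have hm : 0 ≤ (m : ℝ) ^ 2 / a ^ 2 := by positivity
  have hn : 0 ≤ (n : ℝ) ^ 2 / b ^ 2 := by positivity
  have h1 : (m : ℝ) ^ 2 / a ^ 2 ≤ t := by nlinarith
  have h2 : (n : ℝ) ^ 2 / b ^ 2 ≤ t := by nlinarith
  rw [div_le_iff₀ (by positivity)] at h1 h2
  exact ⟨int_bound _ _ h1, int_bound _ _ h2⟩

lemma kb_bdd (a b : ℝ) (k : ℕ) : BddBelow {t : ℝ | 0 ≤ t ∧ k + 1 ≤ (kbSet a b t).ncard} :=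
  ⟨0, fun _ h => h.1⟩

/-- a family of `k+1` points gives membership -/
lemma kb_mem (a b t : ℝ) (ha : 0 < a) (hb : 0 < b) (k : ℕ) (ht : 0 ≤ t) (f : ℕ → ℤ × ℤ)
    (hf : Function.Injective f) (h : ∀ j ≤ k, f j ∈ kbSet a b t) :
    t ∈ {t : ℝ | 0 ≤ t ∧ k + 1 ≤ (kbSet a b t).ncard} := by
  refine ⟨ht, ?_⟩
  have hs : (((Finset.range (k + 1)).image f : Finset (ℤ × ℤ)) : Set (ℤ × ℤ)) ⊆ kbSet a b t := by
    intro p hp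
    simp only [Finset.coe_image, Set.mem_image, Finset.coe_range, Set.mem_Iio] at hp
    obtain ⟨j, hj, rfl⟩ := hp
    exact h j (by omega)
  have := Set.ncard_le_ncard hs (kbSet_finite a b t ha hb)
  rwa [Set.ncard_coe_finset, Finset.card_image_of_injective _ hf, Finset.card_range] at this

lemma kb_mem_b (a b : ℝ) (ha : 0 < a) (hb : 0 < b) (k : ℕ) :
    4 * Real.pi ^ 2 * ((k : ℝ) ^ 2 / b ^ 2) ∈
      {t : ℝ | 0 ≤ t ∧ k + 1 ≤ (kbSet a b t).ncard} := by
  apply kb_mem a b _ ha hb k (by positivity) (fun j => (0, (j : ℤ)))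
  · intro i j h
    simpa using h
  · intro j hj
    refine ⟨?_, ?_⟩
    · rcases Nat.eq_zero_or_pos j with rfl | h
      · right; simp
      · left; simp only; omega
    · have : (j : ℝ) ≤ k := by exact_mod_cast hj
      simp only [Int.cast_zero, Int.cast_natCast]
      rw [zero_pow two_ne_zero, zero_div, zero_add]
      gcongr

lemma kb_mem_a (a b : ℝ) (ha : 0 < a) (hb : 0 < b) (k : ℕ) :
    4 * Real.pi ^ 2 * ((2 * k : ℝ) ^ 2 / a ^ 2) ∈
      {t : ℝ | 0 ≤ t ∧ k + 1 ≤ (kbSet a b t).ncard} := by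
  apply kb_mem a b _ ha hb k (by positivity) (fun j => (2 * (j : ℤ), 0))
  · intro i j h
    simpa using h
  · intro j hj
    refine ⟨?_, ?_⟩
    · right; simp
    · have : (j : ℝ) ≤ k := by exact_mod_cast hj
      simp only [Int.cast_zero, Int.cast_natCast, Int.cast_mul, Int.cast_ofNat]
      rw [zero_pow two_ne_zero, zero_div, add_zero]
      gcongr

lemma kb_compare (a b a' b' C : ℝ) (ha : 0 < a) (hb : 0 < b) (ha' : 0 < a') (hb' : 0 < b')
    (hC : 0 < C) (k : ℕ) (h1 : a ^ 2 ≤ C * a' ^ 2) (h2 : b ^ 2 ≤ C * b' ^ 2) :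
    kleinEig a' b' k ≤ C * kleinEig a b k := by
  rw [mul_comm, ← div_le_iff₀ hC]
  refine le_csInf ⟨_, kb_mem_b a b ha hb k⟩ ?_
  rintro t ⟨ht, hk⟩
  rw [div_le_iff₀ hC]
  refine csInf_le (kb_bdd a' b' k) ⟨by positivity, hk.trans ?_⟩
  refine Set.ncard_le_ncard ?_ (kbSet_finite a' b' _ ha' hb')
  rintro ⟨m, n⟩ ⟨hI, h⟩
  refine ⟨hI, ?_⟩
  simp only at h ⊢
  have e1 : (m : ℝ) ^ 2 / a' ^ 2 ≤ C * ((m : ℝ) ^ 2 / a ^ 2) := by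
    rw [← mul_div_assoc, div_le_div_iff₀ (by positivity) (by positivity)]
    nlinarith [sq_nonneg (m : ℝ)]
  have e2 : (n : ℝ) ^ 2 / b' ^ 2 ≤ C * ((n : ℝ) ^ 2 / b ^ 2) := by
    rw [← mul_div_assoc, div_le_div_iff₀ (by positivity) (by positivity)]
    nlinarith [sq_nonneg (n : ℝ)]
  calc 4 * Real.pi ^ 2 * ((m : ℝ) ^ 2 / a' ^ 2 + (n : ℝ) ^ 2 / b' ^ 2)
      ≤ 4 * Real.pi ^ 2 * (C * ((m : ℝ) ^ 2 / a ^ 2) + C * ((n : ℝ) ^ 2 / b ^ 2)) := by gcongr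
    _ = (4 * Real.pi ^ 2 * ((m : ℝ) ^ 2 / a ^ 2 + (n : ℝ) ^ 2 / b ^ 2)) * C := by ring
    _ ≤ t * C := by gcongr

lemma kb_one (k : ℕ) (hk : 1 ≤ k) : 1 ≤ kleinEig 1 2 k := by
  refine le_csInf ⟨_, kb_mem_b 1 2 one_pos two_pos k⟩ ?_
  rintro t ⟨ht, h⟩
  by_contra! hlt
  have hs : kbSet 1 2 t ⊆ {(0, 0)} := by
    rintro ⟨m, n⟩ ⟨-, h⟩
    simp only at h
    have hpi : 4 ≤ Real.pi ^ 2 := by nlinarith [Real.pi_gt_three]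
    have h3 : 4 * (m : ℝ) ^ 2 + (n : ℝ) ^ 2 < 1 := by
      nlinarith [sq_nonneg (m : ℝ), sq_nonneg (n : ℝ)]
    have h4 : 4 * m ^ 2 + n ^ 2 < 1 := by exact_mod_cast h3
    have hm : m = 0 := by
      apply pow_eq_zero_iff two_ne_zero |>.mp
      nlinarith [sq_nonneg m, sq_nonneg n]
    have hn : n = 0 := by
      apply pow_eq_zero_iff two_ne_zero |>.mp
      nlinarith [sq_nonneg m, sq_nonneg n]
    simp [hm, hn]
  have h5 := Set.ncard_le_ncard hs
  rw [Set.ncard_singleton] at h5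
  have h6 : k + 1 ≤ (kbSet 1 2 t).ncard := h
  omega

/-- For every `k ≥ 1` the `k`-th Laplace eigenvalue is maximised among
unit-volume flat Klein bottles (`ab = 2`). -/
theorem stmt_17 (k : ℕ) (hk : 1 ≤ k) :
    ∃ a b : ℝ, 0 < a ∧ 0 < b ∧ a * b = 2 ∧
      ∀ a' b' : ℝ, 0 < a' → 0 < b' → a' * b' = 2 → kleinEig a' b' k ≤ kleinEig a b k := by
  have hk' : (1 : ℝ) ≤ k := by exact_mod_cast hk
  set M : ℝ := 4 * Real.pi * k with hM
  have hM1 : 1 ≤ M := by nlinarith [Real.pi_gt_three]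
  have hM0 : 0 < M := by linarith
  have hinv : 1 / M ≤ 1 := by rw [div_le_one hM0]; exact hM1
  have husc : UpperSemicontinuousOn (fun a : ℝ => kleinEig a (2 / a) k) (Set.Icc (1 / M) M) := by
    intro a ha y hy
    have ha0 : 0 < a := lt_of_lt_of_le (by positivity) ha.1
    have hc : ContinuousAt (fun x : ℝ => max ((a / x) ^ 2) ((x / a) ^ 2) * kleinEig a (2 / a) k) a := by
      have : ContinuousAt (fun x : ℝ => a / x) a :=
        continuousAt_const.div continuousAt_id ha0.ne'
      have h2 : ContinuousAt (fun x : ℝ => x / a) a := by fun_prop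
      exact ((this.pow 2).max (h2.pow 2)).mul continuousAt_const
    have hlt : max ((a / a) ^ 2) ((a / a) ^ 2) * kleinEig a (2 / a) k < y := by
      rw [div_self ha0.ne']; simpa using hy
    have hev := hc.eventually_lt continuousAt_const hlt
    filter_upwards [mem_nhdsWithin_of_mem_nhds hev, self_mem_nhdsWithin] with x hx hxI
    have hx0 : 0 < x := lt_of_lt_of_le (by positivity) hxI.1
    refine lt_of_le_of_lt ?_ hx
    apply kb_compare a (2 / a) x (2 / x) _ ha0 (by positivity) hx0 (by positivity)
    · exact lt_of_lt_of_le (by positivity) (le_max_left _ _)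
    · calc a ^ 2 = (a / x) ^ 2 * x ^ 2 := by field_simp
        _ ≤ _ := by gcongr; exact le_max_left _ _
    · calc (2 / a) ^ 2 = (x / a) ^ 2 * (2 / x) ^ 2 := by field_simp
        _ ≤ _ := by gcongr; exact le_max_right _ _
  obtain ⟨a, haI, hmax⟩ := UpperSemicontinuousOn.exists_isMaxOn (s := Set.Icc (1 / M) M) ⟨1, hinv, hM1⟩ isCompact_Icc husc
  have ha0 : 0 < a := lt_of_lt_of_le (by positivity) haI.1
  have hge : 1 ≤ kleinEig a (2 / a) k := by
    have h1 := hmax (show (1 : ℝ) ∈ Set.Icc (1 / M) M from ⟨hinv, hM1⟩)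
    exact (kb_one k hk).trans (by simpa using h1)
  refine ⟨a, 2 / a, ha0, by positivity, by field_simp, ?_⟩
  intro x y hx hy hxy
  have hyx : y = 2 / x := by field_simp; linarith
  by_cases h1 : x ≤ M
  · by_cases h2 : 1 / M ≤ x
    · subst hyx
      exact hmax (show x ∈ Set.Icc (1 / M) M from ⟨h2, h1⟩)
    · push Not at h2
      rw [lt_div_iff₀ hM0] at h2
      have hy2 : M ≤ y := by
        by_contra! h
        nlinarith
      refine le_trans (csInf_le (kb_bdd x y k) (kb_mem_b x y hx hy k)) (le_trans ?_ hge)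
      rw [← mul_div_assoc, div_le_one (by positivity)]
      nlinarith [sq_nonneg (Real.pi * k)]
  · push Not at h1
    refine le_trans (csInf_le (kb_bdd x y k) (kb_mem_a x y hx hy k)) (le_trans ?_ hge)
    rw [← mul_div_assoc, div_le_one (by positivity)]
    nlinarith [sq_nonneg (Real.pi * k)]
end
end

section
/- There exist constants c, C > 0 and K₀ ∈ ℕ such that for every k ≥ K₀ and every pair a, b > 0 with ab = 2 maximising λ_k among unit-volume flat Klein bottles (i.e. λ_k(a,b) ≥ λ_k(a′,b′) for all a′, b′ > 0 with a′b′ = 2), one has c k^{−1/2} ≤ min(a, b/2) ≤ C k^{−1/2}. In particular the injectivity radius of any sequence of maximising Klein bottles tends to 0, so the sequence has no accumulation point among unit-volume flat Klein bottles. -/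
noncomputable section

/-- The index set below level `t`. -/
def kleinSet (a b t : ℝ) : Set (ℤ × ℤ) :=
  {p : ℤ × ℤ | (1 ≤ p.2 ∨ (p.2 = 0 ∧ Even p.1)) ∧
      4 * Real.pi ^ 2 * ((p.1 : ℝ) ^ 2 / a ^ 2 + (p.2 : ℝ) ^ 2 / b ^ 2) ≤ t}

lemma klein_coord_bound (a u : ℝ) (ha : 0 < a) (hu : 0 ≤ u) (m : ℤ)
    (h : (m : ℝ) ^ 2 / a ^ 2 ≤ u) : m ∈ Finset.Icc (-⌈a * √u⌉) ⌈a * √u⌉ := by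
  have h1 : (m : ℝ) ^ 2 ≤ (a * √u) ^ 2 := by
    rw [mul_pow, Real.sq_sqrt hu]
    rw [div_le_iff₀ (by positivity)] at h
    linarith
  have h2 := abs_le_of_sq_le_sq h1 (by positivity)
  have h3 := Int.le_ceil (a * √u)
  rw [Finset.mem_Icc]
  constructor
  · have : ((-⌈a * √u⌉ : ℤ) : ℝ) ≤ m := by push_cast; linarith [(abs_le.1 h2).1]
    exact_mod_cast this
  · have : (m : ℝ) ≤ ((⌈a * √u⌉ : ℤ) : ℝ) := by linarith [(abs_le.1 h2).2]
    exact_mod_cast this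

lemma kleinSet_finite (a b t : ℝ) (ha : 0 < a) (hb : 0 < b) (ht : 0 ≤ t) :
    (kleinSet a b t).Finite := by
  set u := t / (4 * Real.pi ^ 2) with hu
  have hpi : 0 < 4 * Real.pi ^ 2 := by positivity
  have hu0 : 0 ≤ u := by positivity
  apply Set.Finite.subset (Finset.finite_toSet
    ((Finset.Icc (-⌈a * √u⌉) ⌈a * √u⌉) ×ˢ (Finset.Icc (-⌈b * √u⌉) ⌈b * √u⌉)))
  rintro ⟨m, n⟩ ⟨-, h⟩
  have h1 : (m : ℝ) ^ 2 / a ^ 2 + (n : ℝ) ^ 2 / b ^ 2 ≤ u := by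
    rw [hu, le_div_iff₀ hpi]; simp only at h; linarith
  have h2 : 0 ≤ (m : ℝ) ^ 2 / a ^ 2 := by positivity
  have h3 : 0 ≤ (n : ℝ) ^ 2 / b ^ 2 := by positivity
  rw [Finset.mem_coe, Finset.mem_product]
  exact ⟨klein_coord_bound a u ha hu0 m (by linarith), klein_coord_bound b u hb hu0 n (by linarith)⟩

lemma kleinEig_le (a b t : ℝ) (k : ℕ) (ha : 0 < a) (hb : 0 < b) (ht : 0 ≤ t)
    (F : Finset (ℤ × ℤ)) (hF : ∀ p ∈ F, p ∈ kleinSet a b t) (hk : k + 1 ≤ F.card) :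
    kleinEig a b k ≤ t := by
  apply csInf_le ⟨0, fun _ h => h.1⟩
  refine ⟨ht, hk.trans ?_⟩
  rw [← Set.ncard_coe_finset]
  exact Set.ncard_le_ncard hF (kleinSet_finite a b t ha hb ht)

lemma kleinEig_test (k : ℕ) (hk : 1 ≤ k) (a b : ℝ) (ha : 0 < a) (hb : 0 < b)
    (ha2 : a ^ 2 = 2 / k) (hb2 : b ^ 2 = 2 * k) : 2 * Real.pi ^ 2 * k ≤ kleinEig a b k := by
  have hk0 : (0 : ℝ) < k := by exact_mod_cast hk
  have hpi : 0 < Real.pi ^ 2 := by positivity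
  apply le_csInf
  · refine ⟨4 * Real.pi ^ 2 * ((k + 1 : ℝ) ^ 2 / b ^ 2), by positivity, ?_⟩
    have : (((Finset.Icc (1 : ℤ) (k + 1)).image (fun n => ((0 : ℤ), n)) : Finset (ℤ × ℤ)) :
        Set (ℤ × ℤ)) ⊆ kleinSet a b (4 * Real.pi ^ 2 * ((k + 1 : ℝ) ^ 2 / b ^ 2)) := by
      intro p hp
      simp only [Finset.coe_image, Set.mem_image, Finset.mem_coe, Finset.mem_Icc] at hp
      obtain ⟨n, ⟨h1, h2⟩, rfl⟩ := hp
      refine ⟨Or.inl h1, ?_⟩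
      have h1' : (1 : ℝ) ≤ n := by exact_mod_cast h1
      have h2' : (n : ℝ) ≤ k + 1 := by exact_mod_cast h2
      have : (n : ℝ) ^ 2 ≤ (k + 1) ^ 2 := by gcongr
      simp only [Int.cast_zero, ne_eq, OfNat.ofNat_ne_zero, not_false_eq_true, zero_pow, zero_div,
        zero_add]
      gcongr
    have h := Set.ncard_le_ncard this (kleinSet_finite a b _ ha hb (by positivity))
    rw [Set.ncard_coe_finset, Finset.card_image_of_injective _ (fun x y h => by simpa using h)] at h
    simp only [Int.card_Icc] at h
    refine le_trans ?_ h
    omega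
  · rintro t ⟨ht, hc⟩
    by_contra! hlt
    change k + 1 ≤ (kleinSet a b t).ncard at hc
    have : kleinSet a b t ⊆ (((Finset.Ico (0 : ℤ) k).image (fun n => ((0 : ℤ), n)) :
        Finset (ℤ × ℤ)) : Set (ℤ × ℤ)) := by
      rintro ⟨m, n⟩ ⟨h1, h2⟩
      simp only at h1 h2
      have h3 : (m : ℝ) ^ 2 / a ^ 2 + (n : ℝ) ^ 2 / b ^ 2 < k / 2 := by
        by_contra! h
        have := mul_le_mul_of_nonneg_left h (by positivity : 0 ≤ 4 * Real.pi ^ 2)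
        nlinarith
      have h4 : 0 ≤ (m : ℝ) ^ 2 / a ^ 2 := by positivity
      have h5 : 0 ≤ (n : ℝ) ^ 2 / b ^ 2 := by positivity
      have h6 : (m : ℝ) ^ 2 / a ^ 2 < k / 2 := by linarith
      have h7 : (n : ℝ) ^ 2 / b ^ 2 < k / 2 := by linarith
      rw [div_lt_iff₀ (by positivity), ha2] at h6
      rw [div_lt_iff₀ (by positivity), hb2] at h7
      have h8 : (m : ℝ) ^ 2 < 1 := by
        have : (k : ℝ) / 2 * (2 / k) = 1 := by field_simp
        linarith
      have h9 : (n : ℝ) ^ 2 < (k : ℝ) ^ 2 := by nlinarith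
      have h8' : m ^ 2 < 1 := by exact_mod_cast h8
      have hm : m = 0 := by
        by_contra h
        have := Int.one_le_abs h
        nlinarith [sq_abs m]
      have h10 : (n : ℝ) < k := lt_of_pow_lt_pow_left₀ 2 hk0.le h9
      have h11 : n < k := by exact_mod_cast h10
      simp only [Finset.coe_image, Set.mem_image, Finset.mem_coe, Finset.mem_Ico]
      exact ⟨n, ⟨by omega, h11⟩, by rw [hm]⟩
    have h := Set.ncard_le_ncard this (Finset.finite_toSet _)
    rw [Set.ncard_coe_finset, Finset.card_image_of_injective _ (fun x y h => by simpa using h)] at h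
    simp at h
    omega

lemma klein_card_le (k : ℕ) (hk : 1 ≤ k) (a b r : ℝ) (ha : 0 < a) (hb : 0 < b)
    (hr2 : r ^ 2 = 49 / 100 * k)
    (hmax : ∀ a' b' : ℝ, 0 < a' → 0 < b' → a' * b' = 2 → kleinEig a' b' k ≤ kleinEig a b k)
    (F : Finset (ℤ × ℤ)) (hF : ∀ p ∈ F, (1 ≤ p.2 ∨ (p.2 = 0 ∧ Even p.1)) ∧
      ∃ α β : ℝ, α ^ 2 + β ^ 2 ≤ 1 ∧ |(p.1 : ℝ)| ≤ α * (a * r) ∧ |(p.2 : ℝ)| ≤ β * (b * r)) :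
    F.card ≤ k := by
  have hk0 : (0 : ℝ) < k := by exact_mod_cast hk
  have hpi : 0 < Real.pi ^ 2 := by positivity
  by_contra! hc
  have h1 := hmax (√(2 / k)) (√(2 * k)) (by positivity) (by positivity) (by
    rw [← Real.sqrt_mul (by positivity)]
    rw [show (2 : ℝ) / k * (2 * k) = 2 ^ 2 by field_simp]
    exact Real.sqrt_sq (by norm_num))
  have h2 := kleinEig_test k hk (√(2 / k)) (√(2 * k)) (by positivity) (by positivity)
    (Real.sq_sqrt (by positivity)) (Real.sq_sqrt (by positivity))
  have h3 := kleinEig_le a b (4 * Real.pi ^ 2 * r ^ 2) k ha hb (by positivity) F (by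
    intro p hp
    obtain ⟨h, α, β, hab, hα, hβ⟩ := hF p hp
    refine ⟨h, ?_⟩
    have e1 : (p.1 : ℝ) ^ 2 ≤ (α * (a * r)) ^ 2 := by
      rw [← sq_abs (p.1 : ℝ)]; gcongr
    have e2 : (p.2 : ℝ) ^ 2 ≤ (β * (b * r)) ^ 2 := by
      rw [← sq_abs (p.2 : ℝ)]; gcongr
    have e3 : (p.1 : ℝ) ^ 2 / a ^ 2 ≤ α ^ 2 * r ^ 2 := by
      rw [div_le_iff₀ (by positivity)]; linarith
    have e4 : (p.2 : ℝ) ^ 2 / b ^ 2 ≤ β ^ 2 * r ^ 2 := by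
      rw [div_le_iff₀ (by positivity)]; linarith
    gcongr
    nlinarith [sq_nonneg r]) hc
  rw [hr2] at h3
  nlinarith [mul_pos hpi hk0]

lemma klein_main (k : ℕ) (hk : 100 ≤ k) (a b r : ℝ) (ha : 0 < a) (hb : 0 < b) (hr : 0 < r)
    (hab : a * b = 2) (hr2 : r ^ 2 = 49 / 100 * k)
    (hmax : ∀ a' b' : ℝ, 0 < a' → 0 < b' → a' * b' = 2 → kleinEig a' b' k ≤ kleinEig a b k) :
    b * r ≤ k ∧ a * r ≤ k + 1 ∧ (a * r < 40 ∨ b * r < 40) := by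
  have key := klein_card_le k (by omega) a b r ha hb hr2 hmax
  have hkR : (100 : ℝ) ≤ k := by exact_mod_cast hk
  have hxy : (a * r) * (b * r) = 98 / 100 * k := by
    rw [show (a * r) * (b * r) = (a * b) * r ^ 2 by ring, hab, hr2]; ring
  have hx : 0 < a * r := by positivity
  have hy : 0 < b * r := by positivity
  generalize a * r = x at *
  generalize b * r = y at *
  refine ⟨?_, ?_, ?_⟩
  · have h := key ((Finset.Icc (0 : ℤ) ⌊y⌋).image (fun n => ((0 : ℤ), n))) (by
      intro p hp
      simp only [Finset.mem_image, Finset.mem_Icc] at hp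
      obtain ⟨n, ⟨h1, h2⟩, rfl⟩ := hp
      refine ⟨?_, 0, 1, by norm_num, by simp, ?_⟩
      · rcases h1.eq_or_lt with h | h
        · right; simp [← h]
        · left; exact h
      · have : (0 : ℝ) ≤ n := by exact_mod_cast h1
        simp only [abs_of_nonneg this, one_mul]
        exact Int.le_floor.1 h2)
    rw [Finset.card_image_of_injective _ (fun x y h => by simpa using h), Int.card_Icc] at h
    have h1 : ⌊y⌋ + 1 ≤ k := by omega
    have h2 : ((⌊y⌋ + 1 : ℤ) : ℝ) ≤ k := by exact_mod_cast h1
    push_cast at h2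
    linarith [Int.lt_floor_add_one y]
  · have h := key ((Finset.Icc (-⌊x / 2⌋) ⌊x / 2⌋).image (fun m => (2 * m, (0 : ℤ)))) (by
      intro p hp
      simp only [Finset.mem_image, Finset.mem_Icc] at hp
      obtain ⟨n, ⟨h1, h2⟩, rfl⟩ := hp
      refine ⟨Or.inr ⟨rfl, even_two_mul n⟩, 1, 0, by norm_num, ?_, by simp⟩
      have e := Int.floor_le (x / 2)
      have h1' : (-⌊x / 2⌋ : ℝ) ≤ n := by exact_mod_cast h1
      have h2' : (n : ℝ) ≤ ⌊x / 2⌋ := by exact_mod_cast h2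
      rw [abs_le]
      push_cast
      constructor <;> linarith)
    rw [Finset.card_image_of_injective _ (fun x y h => by simpa using h), Int.card_Icc] at h
    have h1 : 2 * ⌊x / 2⌋ + 1 ≤ k := by omega
    have h2 : ((2 * ⌊x / 2⌋ + 1 : ℤ) : ℝ) ≤ k := by exact_mod_cast h1
    push_cast at h2
    linarith [Int.lt_floor_add_one (x / 2)]
  · by_contra! hcon
    obtain ⟨hx40, hy40⟩ := hcon
    obtain ⟨P, hP⟩ : ∃ P, P = ⌊3 / 5 * y⌋ := ⟨_, rfl⟩
    obtain ⟨Q, hQ⟩ : ∃ P, P = ⌊4 / 5 * y⌋ := ⟨_, rfl⟩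
    obtain ⟨A, hA⟩ : ∃ P, P = ⌊4 / 5 * x⌋ := ⟨_, rfl⟩
    obtain ⟨B, hB⟩ : ∃ P, P = ⌊3 / 5 * x⌋ := ⟨_, rfl⟩
    have hP1 : (P : ℝ) ≤ 3 / 5 * y := hP ▸ Int.floor_le _
    have hQ1 : (Q : ℝ) ≤ 4 / 5 * y := hQ ▸ Int.floor_le _
    have hA1 : (A : ℝ) ≤ 4 / 5 * x := hA ▸ Int.floor_le _
    have hB1 : (B : ℝ) ≤ 3 / 5 * x := hB ▸ Int.floor_le _
    have hP2 : 3 / 5 * y < P + 1 := hP ▸ Int.lt_floor_add_one _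
    have hQ2 : 4 / 5 * y < Q + 1 := hQ ▸ Int.lt_floor_add_one _
    have hA2 : 4 / 5 * x < A + 1 := hA ▸ Int.lt_floor_add_one _
    have hB2 : 3 / 5 * x < B + 1 := hB ▸ Int.lt_floor_add_one _
    have hP0 : 0 ≤ P := by rw [hP]; positivity
    have hA0 : 0 ≤ A := by rw [hA]; positivity
    have hB0 : 0 ≤ B := by rw [hB]; positivity
    have hPQ : P ≤ Q := by rw [hP, hQ]; gcongr; norm_num
    have h := key ((Finset.Icc (-A) A ×ˢ Finset.Icc 1 P) ∪
        (Finset.Icc (-B) B ×ˢ Finset.Icc (P + 1) Q)) (by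
      rintro ⟨m, n⟩ hp
      simp only [Finset.mem_union, Finset.mem_product, Finset.mem_Icc] at hp
      rcases hp with ⟨⟨h1, h2⟩, h3, h4⟩ | ⟨⟨h1, h2⟩, h3, h4⟩
      · refine ⟨Or.inl h3, 4 / 5, 3 / 5, by norm_num, ?_, ?_⟩
        · have h1' : (-A : ℝ) ≤ m := by exact_mod_cast h1
          have h2' : (m : ℝ) ≤ A := by exact_mod_cast h2
          rw [abs_le]; simp only; constructor <;> linarith
        · have h1' : (1 : ℝ) ≤ n := by exact_mod_cast h3
          have h2' : (n : ℝ) ≤ P := by exact_mod_cast h4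
          rw [abs_le]; simp only; constructor <;> linarith
      · refine ⟨Or.inl (by simp only; omega), 3 / 5, 4 / 5, by norm_num, ?_, ?_⟩
        · have h1' : (-B : ℝ) ≤ m := by exact_mod_cast h1
          have h2' : (m : ℝ) ≤ B := by exact_mod_cast h2
          rw [abs_le]; simp only; constructor <;> linarith
        · have h1' : (1 : ℝ) ≤ n := by exact_mod_cast (by omega : 1 ≤ n)
          have h2' : (n : ℝ) ≤ Q := by exact_mod_cast h4
          rw [abs_le]; simp only; constructor <;> linarith)
    rw [Finset.card_union_of_disjoint (by
      rw [Finset.disjoint_left]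
      rintro ⟨m, n⟩ h1 h2
      simp only [Finset.mem_product, Finset.mem_Icc] at h1 h2
      omega), Finset.card_product, Finset.card_product] at h
    simp only [Int.card_Icc] at h
    have h' : (2 * A + 1) * P + (2 * B + 1) * (Q - P) ≤ k := by
      have h'' := Int.ofNat_le.2 h
      push_cast at h''
      rw [Int.toNat_of_nonneg (by omega), Int.toNat_of_nonneg (by omega),
        Int.toNat_of_nonneg (by omega), Int.toNat_of_nonneg (by omega)] at h''
      linarith
    have hR : (2 * (A : ℝ) + 1) * P + (2 * B + 1) * (Q - P) ≤ k := by exact_mod_cast h'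
    have g1 : (3 / 5 * y - 1) * (2 / 5 * x - 2) ≤ P * (2 * (A - B)) := by
      apply mul_le_mul <;> first | linarith | exact_mod_cast hP0
    have g2 : (4 / 5 * y - 1) * (6 / 5 * x - 1) ≤ Q * (2 * B + 1) := by
      apply mul_le_mul <;> first | linarith | exact_mod_cast hP0.trans hPQ
    nlinarith [mul_nonneg (sub_nonneg.2 hx40) hy.le, mul_nonneg (sub_nonneg.2 hy40) hx.le]

theorem stmt_18 :
    ∃ c > (0 : ℝ), ∃ C > (0 : ℝ), ∃ K₀ : ℕ, ∀ k : ℕ, K₀ ≤ k →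
      ∀ a b : ℝ, 0 < a → 0 < b → a * b = 2 →
        (∀ a' b' : ℝ, 0 < a' → 0 < b' → a' * b' = 2 →
          kleinEig a' b' k ≤ kleinEig a b k) →
        c * (k : ℝ) ^ (-(1 : ℝ) / 2) ≤ min a (b / 2) ∧
          min a (b / 2) ≤ C * (k : ℝ) ^ (-(1 : ℝ) / 2) := by
  refine ⟨1 / 4, by norm_num, 80, by norm_num, 100, ?_⟩
  intro k hk a b ha hb hab hmax
  have hkR : (100 : ℝ) ≤ k := by exact_mod_cast hk
  have hs2 : √(k : ℝ) ^ 2 = k := Real.sq_sqrt (by linarith)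
  have hs : 0 < √(k : ℝ) := Real.sqrt_pos.2 (by linarith)
  have hpow : (k : ℝ) ^ (-(1 : ℝ) / 2) = 1 / √k := by
    rw [neg_div, Real.rpow_neg (by linarith), ← Real.sqrt_eq_rpow, one_div]
  obtain ⟨h1, h2, h3⟩ := klein_main k hk a b (7 / 10 * √k) ha hb (by positivity) hab
    (by rw [mul_pow, hs2]; norm_num) hmax
  rw [hpow]
  generalize √(k : ℝ) = s at *
  rw [← hs2] at h1 h2 hkR
  have hs1 : 1 ≤ s := by nlinarith
  have h1' : b * (7 / 10) ≤ s := by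
    by_contra! h; nlinarith
  have h2' : a * (7 / 10) ≤ 2 * s := by
    by_contra! h; nlinarith
  rw [mul_one_div, mul_one_div, le_min_iff, div_le_iff₀ hs, div_le_iff₀ hs, min_le_iff,
    le_div_iff₀ hs, le_div_iff₀ hs]
  refine ⟨⟨by nlinarith, by nlinarith⟩, ?_⟩
  rcases h3 with h | h
  · left; nlinarith
  · right; nlinarith
end
end
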